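/- Let H be a division ring of finite dimension over its center k, with k infinite, and let F be a division ring that is a classical right quotient ring of the ring H[X] of polynomial functions on H (via an injective ring homomorphism). Then every finite abelian group G occurs as the Galois group of a Galois extension of F: there exist a division ring M and an injective ring homomorphism ι : F → M such that M/F is Galois with Galois group isomorphic to G. -/

import Mathlib

universe u v w x

/-- The subgroup of ring automorphisms of `M` fixing the image of `ι` pointwise
(the Galois group of the extension `M/F` given by `ι`). -/
def fixingAut {F M : Type*} [DivisionRing F] [DivisionRing M] (ι : F →+* M) :
    Subgroup (RingAut M) where
  carrier := {σ | ∀ x : F, σ (ι x) = ι x}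
  one_mem' := fun _ => rfl
  mul_mem' := by
    intro a b ha hb x
    show a (b (ι x)) = ι x
    rw [hb x, ha x]
  inv_mem' := by
    intro a ha x
    show a.symm (ι x) = ι x
    conv_lhs => rw [← ha x]
    exact a.symm_apply_apply _

/-- The extension `M/F` given by `ι : F →+* M` is Galois: every element of `M` fixed by all
ring automorphisms of `M` fixing `ι(F)` pointwise lies in `ι(F)`. -/
def IsGaloisExt {F M : Type*} [DivisionRing F] [DivisionRing M] (ι : F →+* M) : Prop :=
  ∀ m : M, (∀ σ ∈ fixingAut ι, σ m = m) → m ∈ Set.range ι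

/-- The ring `H[X]` of polynomial functions on a division ring `H`: the subring of `H → H`
(with pointwise operations) generated by the constant functions and the identity function. -/
def polyFunRing (H : Type*) [DivisionRing H] : Subring (H → H) :=
  Subring.closure ({f | ∃ c : H, f = Function.const H c} ∪ {id})

/-- `F` is a classical right quotient ring of `R` via the injective ring homomorphism `φ`:
every element of `F` is of the form `φ a * (φ b)⁻¹` with `b ≠ 0`. -/
def IsClassicalRightQuotient {R F : Type*} [Ring R] [DivisionRing F] (φ : R →+* F) : Prop :=
  Function.Injective φ ∧ ∀ x : F, ∃ a b : R, b ≠ 0 ∧ x = φ a * (φ b)⁻¹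

/-- Auxiliary construction for the iterated polynomial ring. -/
noncomputable def IterPolyAux (H : Type u) [Ring H] : ℕ → ((T : Type u) × Ring T)
  | 0 => ⟨H, inferInstance⟩
  | n + 1 =>
    letI := (IterPolyAux H n).2
    ⟨Polynomial (IterPolyAux H n).1, inferInstance⟩

/-- The iterated polynomial ring `H_c[t₁, …, t_n]` in `n` central variables over `H`:
`IterPoly H 0 = H` and `IterPoly H (n + 1) = Polynomial (IterPoly H n)`. -/
def IterPoly (H : Type u) [Ring H] (n : ℕ) : Type u := (IterPolyAux H n).1

noncomputable instance (H : Type u) [Ring H] (n : ℕ) : Ring (IterPoly H n) :=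
  (IterPolyAux H n).2

/-! ### Fields of rational functions inside fields of power series -/

/-- `Ω` is the field of Laurent series over `S` (as a fraction field of `S⟦X⟧`), `K` is the field of
rational functions over `k ⊆ S`, and the embedding of `K` into `Ω` is the expansion at `0`. -/
class IsSeriesExpansion (k S K Ω : Type*) [Field k] [Field S] [Field K] [Field Ω] [Algebra k S]
    [Algebra (Polynomial k) K] [Algebra (PowerSeries S) Ω] [Algebra K Ω] : Prop where
  algebraMap_polynomial : ∀ P : Polynomial k, algebraMap K Ω (algebraMap (Polynomial k) K P) =
    algebraMap (PowerSeries S) Ω (P.map (algebraMap k S) : Polynomial S)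

namespace SeriesExpansion

section Hensel

variable {S : Type*} [Field S]

theorem mem_span_X_iff (f : PowerSeries S) :
    f ∈ Ideal.span {(PowerSeries.X : PowerSeries S)} ↔ PowerSeries.constantCoeff f = 0 := by
  rw [Ideal.mem_span_singleton, PowerSeries.X_dvd_iff]

theorem exists_root_of_simple_root (P : Polynomial (PowerSeries S)) (hP : P.Monic)
    (a₀ : PowerSeries S) (h₀ : PowerSeries.constantCoeff (P.eval a₀) = 0)
    (h₁ : PowerSeries.constantCoeff (P.derivative.eval a₀) ≠ 0) :
    ∃ a, P.eval a = 0 ∧ PowerSeries.constantCoeff a = PowerSeries.constantCoeff a₀ := by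
  have hH := IsAdicComplete.henselianRing (PowerSeries S)
    (Ideal.span {(PowerSeries.X : PowerSeries S)})
  obtain ⟨a, ha, ha'⟩ := hH.is_henselian P hP a₀ ((mem_span_X_iff _).2 h₀)
    (IsUnit.map _ (PowerSeries.isUnit_iff_constantCoeff.2 (isUnit_iff_ne_zero.2 h₁)))
  refine ⟨a, ha, ?_⟩
  have := (mem_span_X_iff _).1 ha'
  rwa [map_sub, sub_eq_zero] at this

theorem exists_nth_root (n : ℕ) (hn : (n : S) ≠ 0) (f : PowerSeries S)
    (hf : PowerSeries.constantCoeff f = 1) :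
    ∃ y, y ^ n = f ∧ PowerSeries.constantCoeff y = 1 := by
  have hn0 : n ≠ 0 := by rintro rfl; simp at hn
  obtain ⟨y, hy, hy'⟩ := exists_root_of_simple_root (Polynomial.X ^ n - Polynomial.C f)
    (Polynomial.monic_X_pow_sub_C f hn0) 1 (by simp [hf])
    (by simpa [Polynomial.derivative_X_pow] using hn)
  refine ⟨y, ?_, by simpa using hy'⟩
  simpa [sub_eq_zero] using hy

theorem nth_root_unique (n : ℕ) (hn : (n : S) ≠ 0) {y z : PowerSeries S} (h : y ^ n = z ^ n)
    (hy : PowerSeries.constantCoeff y = 1) (hz : PowerSeries.constantCoeff z = 1) : y = z := by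
  have h1 := (Commute.all y z).geom_sum₂_mul n
  rw [h, sub_self, mul_eq_zero] at h1
  rcases h1 with h1 | h1
  · exfalso
    apply_fun PowerSeries.constantCoeff at h1
    simp [hy, hz] at h1
    exact hn h1
  · exact sub_eq_zero.1 h1

theorem exists_artinSchreier_root (p : ℕ) [Fact p.Prime] [CharP S p] (f : PowerSeries S)
    (hf : PowerSeries.constantCoeff f = 0) :
    ∃ y, y ^ p - y = f ∧ PowerSeries.constantCoeff y = 0 := by
  have hp : 1 < p := (Fact.out : p.Prime).one_lt
  have hP : (Polynomial.X ^ p - (Polynomial.X + Polynomial.C f)).Monic := by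
    refine Polynomial.monic_X_pow_sub ?_
    rw [Polynomial.degree_X_add_C]
    exact_mod_cast hp
  obtain ⟨y, hy, hy'⟩ := exists_root_of_simple_root _ hP 0
    (by simp [hf, (zero_lt_one.trans hp).ne']) 
    (by simp [Polynomial.derivative_X_pow, (Nat.sub_pos_of_lt hp).ne'])
  refine ⟨y, ?_, by simpa using hy'⟩
  simp only [Polynomial.eval_sub, Polynomial.eval_pow, Polynomial.eval_X, Polynomial.eval_add,
    Polynomial.eval_C] at hy
  linear_combination hy

theorem artinSchreier_root_unique (p : ℕ) [Fact p.Prime] [CharP S p] {y z : PowerSeries S}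
    (h : y ^ p - y = z ^ p - z) (hy : PowerSeries.constantCoeff y = 0)
    (hz : PowerSeries.constantCoeff z = 0) : y = z := by
  have hp : 1 < p := (Fact.out : p.Prime).one_lt
  have : CharP (PowerSeries S) p :=
    charP_of_injective_algebraMap (algebraMap S (PowerSeries S)).injective p
  have h1 : (y - z) * ((y - z) ^ (p - 1) - 1) = 0 := by
    rw [mul_sub, ← pow_succ', Nat.sub_add_cancel hp.le, sub_pow_char]
    linear_combination h
  rcases mul_eq_zero.1 h1 with h1 | h1
  · exact sub_eq_zero.1 h1
  · exfalso
    apply_fun PowerSeries.constantCoeff at h1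
    simp [hy, hz, (Nat.sub_pos_of_lt hp).ne'] at h1

end Hensel

variable (k S K Ω : Type*) [Field k] [Field S] [Field K] [Field Ω] [Algebra k S]
  [Algebra (Polynomial k) K] [Algebra (PowerSeries S) Ω] [Algebra K Ω]

/-- Automorphisms of `S` act on power series coefficientwise. -/
noncomputable def powerSeriesAut : (S ≃ₐ[k] S) →* (PowerSeries S ≃+* PowerSeries S) where
  toFun γ := RingEquiv.ofRingHom (PowerSeries.map (γ : S →+* S)) (PowerSeries.map (γ.symm : S →+* S))
    (by ext f n; simp) (by ext f n; simp)
  map_one' := by ext f n; simp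
  map_mul' γ δ := by ext f n; simp

theorem powerSeriesAut_apply (γ : S ≃ₐ[k] S) (f : PowerSeries S) :
    powerSeriesAut k S γ f = PowerSeries.map (γ : S →+* S) f := rfl

variable [IsFractionRing (PowerSeries S) Ω] [IsFractionRing (Polynomial k) K]
  [IsSeriesExpansion k S K Ω]

/-- Automorphisms of `S` over `k` act on Laurent series coefficientwise, and fix the rational
functions over `k`. -/
noncomputable def seriesAut : (S ≃ₐ[k] S) →* (Ω ≃ₐ[K] Ω) where
  toFun γ := AlgEquiv.ofRingEquiv
    (f := IsFractionRing.ringEquivOfRingEquiv (K := Ω) (L := Ω) (powerSeriesAut k S γ)) (by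
      intro x
      obtain ⟨P, Q, hQ, rfl⟩ := IsFractionRing.div_surjective (A := Polynomial k) x
      simp only [map_div₀, IsSeriesExpansion.algebraMap_polynomial (S := S),
        IsFractionRing.ringEquivOfRingEquiv_algebraMap, powerSeriesAut_apply]
      congr 2 <;> · ext n; simp)
  map_one' := by
    ext x
    obtain ⟨P, Q, hQ, rfl⟩ := IsFractionRing.div_surjective (A := PowerSeries S) x
    simp
  map_mul' γ δ := by
    ext x
    obtain ⟨P, Q, hQ, rfl⟩ := IsFractionRing.div_surjective (A := PowerSeries S) x
    simp

theorem seriesAut_algebraMap (γ : S ≃ₐ[k] S) (f : PowerSeries S) :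
    seriesAut k S K Ω γ (algebraMap _ Ω f) = algebraMap _ Ω (PowerSeries.map (γ : S →+* S) f) :=
  IsFractionRing.ringEquivOfRingEquiv_algebraMap _ _

/-- The Laurent series fixed by all automorphisms of `S` over `k`. -/
noncomputable def invariantSeries : IntermediateField K Ω :=
  IntermediateField.fixedField (seriesAut k S K Ω).range

theorem mem_invariantSeries_iff (x : Ω) :
    x ∈ invariantSeries k S K Ω ↔ ∀ γ : S ≃ₐ[k] S, seriesAut k S K Ω γ x = x := by
  simp [invariantSeries, IntermediateField.mem_fixedField_iff]

theorem algebraMap_X_mem_invariantSeries :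
    algebraMap (PowerSeries S) Ω PowerSeries.X ∈ invariantSeries k S K Ω := by
  rw [mem_invariantSeries_iff]
  intro γ
  rw [seriesAut_algebraMap]
  simp

variable [IsGalois k S]

theorem coeff_mem_range_of_mem_invariantSeries (f : PowerSeries S)
    (hf : algebraMap _ Ω f ∈ invariantSeries k S K Ω) (n : ℕ) :
    ∃ a : k, algebraMap k S a = PowerSeries.coeff n f := by
  rw [mem_invariantSeries_iff] at hf
  refine (InfiniteGalois.mem_range_algebraMap_iff_fixed (k := k) (K := S) _).2 fun γ => ?_
  have := IsFractionRing.injective (PowerSeries S) Ω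
    ((seriesAut_algebraMap k S K Ω γ f).symm.trans (hf γ))
  conv_rhs => rw [← this]
  simp

/-- Subtracting the principal part and the constant term. -/
theorem exists_sub_eq_algebraMap (x : Ω) (hx : x ∈ invariantSeries k S K Ω) :
    ∃ c : K, ∃ f : PowerSeries S, PowerSeries.constantCoeff f = 0 ∧
      x - algebraMap K Ω c = algebraMap _ Ω f := by
  have hX0 : algebraMap (PowerSeries S) Ω PowerSeries.X ≠ 0 := by
    rw [Ne, IsFractionRing.to_map_eq_zero_iff]
    exact PowerSeries.X_ne_zero
  obtain ⟨m, g, hg⟩ : ∃ (m : ℕ) (g : PowerSeries S),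
      x * algebraMap _ Ω (PowerSeries.X : PowerSeries S) ^ m = algebraMap _ Ω g := by
    obtain ⟨P, Q, hQ, rfl⟩ := IsFractionRing.div_surjective (A := PowerSeries S) x
    have hQ0 : Q ≠ 0 := nonZeroDivisors.ne_zero hQ
    have hQ0' : algebraMap (PowerSeries S) Ω Q ≠ 0 := by
      rwa [Ne, IsFractionRing.to_map_eq_zero_iff]
    obtain ⟨n, u, hu⟩ := IsDiscreteValuationRing.eq_unit_mul_pow_irreducible hQ0
      (PowerSeries.X_irreducible (R := S) )
    refine ⟨n, P * ((u⁻¹ : (PowerSeries S)ˣ) : PowerSeries S), ?_⟩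
    have : PowerSeries.X ^ n = ((u⁻¹ : (PowerSeries S)ˣ) : PowerSeries S) * Q := by
      rw [hu, ← mul_assoc]; simp
    rw [← map_pow, this]
    simp only [map_mul]
    field_simp
  have hgD : algebraMap _ Ω g ∈ invariantSeries k S K Ω := by
    rw [← hg]
    exact mul_mem hx (pow_mem (algebraMap_X_mem_invariantSeries k S K Ω) m)
  choose a ha using coeff_mem_range_of_mem_invariantSeries k S K Ω g hgD
  set P : Polynomial k := ∑ i ∈ Finset.range (m + 1), Polynomial.monomial i (a i) with hP
  have hdvd : PowerSeries.X ^ (m + 1) ∣ g - ((P.map (algebraMap k S) : Polynomial S) :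
      PowerSeries S) := by
    rw [PowerSeries.X_pow_dvd_iff]
    intro i hi
    have : P.coeff i = a i := by
      rw [hP, Polynomial.finsetSum_coeff, Finset.sum_eq_single i]
      · simp
      · intro b _ hb
        simp [Polynomial.coeff_monomial, hb]
      · intro h; exact absurd (Finset.mem_range.2 hi) h
    simp [this, ha]
  obtain ⟨r, hr⟩ := hdvd
  have hT : algebraMap K Ω (algebraMap (Polynomial k) K Polynomial.X) =
      algebraMap _ Ω (PowerSeries.X : PowerSeries S) := by
    rw [IsSeriesExpansion.algebraMap_polynomial (S := S)]; simp
  refine ⟨algebraMap _ K P / (algebraMap (Polynomial k) K Polynomial.X) ^ m, PowerSeries.X * r, by simp, ?_⟩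
  rw [map_div₀, map_pow, hT, IsSeriesExpansion.algebraMap_polynomial (S := S)]
  apply mul_right_cancel₀ (pow_ne_zero m hX0)
  rw [sub_mul, hg, div_mul_cancel₀ _ (pow_ne_zero m hX0), ← map_sub, hr]
  simp only [map_mul, map_pow]
  ring

/-- A subfield of the invariant Laurent series has a place with values in `k`. -/
theorem exists_place (L : IntermediateField K Ω) (hL : L ≤ invariantSeries k S K Ω) :
    ∃ (O : ValuationSubring L) (π : O →+* k), ∀ a : k,
      ∃ h : algebraMap K L (algebraMap (Polynomial k) K (Polynomial.C a)) ∈ O, π ⟨_, h⟩ = a := by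
  classical
  have hinj := IsFractionRing.injective (PowerSeries S) Ω
  let O : ValuationSubring L :=
    { ((algebraMap (PowerSeries S) Ω).range.comap (algebraMap L Ω)) with
      mem_or_inv_mem' := by
        intro x
        obtain ⟨a, ha⟩ | ⟨a, ha⟩ := ValuationRing.isInteger_or_isInteger (PowerSeries S)
          (algebraMap L Ω x)
        · exact Or.inl ⟨a, ha⟩
        · refine Or.inr ⟨a, ?_⟩
          rw [ha, map_inv₀] }
  have hO : ∀ x : O, ∃ f : PowerSeries S, algebraMap _ Ω f = algebraMap L Ω x := fun x => x.2
  choose F hF using hO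
  have hk : ∀ x : O, ∃ a : k, algebraMap k S a = PowerSeries.constantCoeff (F x) := by
    intro x
    obtain ⟨a, ha⟩ := coeff_mem_range_of_mem_invariantSeries k S K Ω (F x)
      (by rw [hF]; exact hL x.1.2) 0
    exact ⟨a, by simpa using ha⟩
  choose p hp using hk
  have hpu : ∀ (x : O) (f : PowerSeries S) (a : k), algebraMap _ Ω f = algebraMap L Ω x →
      PowerSeries.constantCoeff f = algebraMap k S a → p x = a := by
    intro x f a h1 h2
    have : f = F x := hinj (h1.trans (hF x).symm)
    apply (algebraMap k S).injective
    rw [hp, ← this, h2]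
  refine ⟨O, { toFun := p, map_one' := ?_, map_mul' := ?_, map_zero' := ?_, map_add' := ?_ }, ?_⟩
  · exact hpu _ 1 _ (by simp) (by simp)
  · intro x y
    exact hpu _ (F x * F y) _ (by simp [hF]) (by simp [hp])
  · exact hpu _ 0 _ (by simp) (by simp)
  · intro x y
    exact hpu _ (F x + F y) _ (by simp [hF]) (by simp [hp])
  · intro a
    have h : algebraMap (PowerSeries S) Ω (PowerSeries.C (algebraMap k S a)) =
        algebraMap L Ω (algebraMap K L (algebraMap (Polynomial k) K (Polynomial.C a))) := by
      rw [← IsScalarTower.algebraMap_apply K L Ω, IsSeriesExpansion.algebraMap_polynomial (S := S)]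
      simp
    exact ⟨⟨_, h⟩, hpu _ _ _ h (by simp)⟩

end SeriesExpansion

/-! ### Compositums of disjoint Galois extensions -/

section Compositum

open IntermediateField

variable {K Ω : Type*} [Field K] [Field Ω] [Algebra K Ω]

/-- The Galois group of a compositum of two disjoint Galois extensions is the product of their
Galois groups. -/
theorem IntermediateField.nonempty_gal_mulEquiv_prod [FiniteDimensional K Ω]
    (A B : IntermediateField K Ω) [IsGalois K A] [IsGalois K B] (hsup : A ⊔ B = ⊤)
    (hinf : A ⊓ B = ⊥) :
    Nonempty ((Ω ≃ₐ[K] Ω) ≃* (A ≃ₐ[K] A) × (B ≃ₐ[K] B)) := by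
  have : IsGalois K Ω := by
    have : IsGalois K (⊤ : IntermediateField K Ω) := hsup ▸ inferInstance
    exact IsGalois.of_algEquiv (IntermediateField.topEquiv (F := K) (E := Ω))
  let f : (Ω ≃ₐ[K] Ω) →* (A ≃ₐ[K] A) × (B ≃ₐ[K] B) :=
    (AlgEquiv.restrictNormalHom A).prod (AlgEquiv.restrictNormalHom B)
  have hf : Function.Injective f := by
    rw [← MonoidHom.ker_eq_bot_iff, MonoidHom.ker_prod, restrictNormalHom_ker,
      restrictNormalHom_ker, ← fixingSubgroup_sup, hsup, fixingSubgroup_top]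
  refine ⟨MulEquiv.ofBijective f ((Nat.bijective_iff_injective_and_card f).2 ⟨hf, ?_⟩)⟩
  rw [Nat.card_prod, IsGalois.card_aut_eq_finrank, IsGalois.card_aut_eq_finrank,
    IsGalois.card_aut_eq_finrank, ← (IntermediateField.LinearDisjoint.of_inf_eq_bot hinf).finrank_sup, hsup,
    finrank_top']

theorem IntermediateField.nonempty_gal_sup_mulEquiv_prod (A B : IntermediateField K Ω)
    [FiniteDimensional K A] [FiniteDimensional K B] [IsGalois K A] [IsGalois K B]
    (hinf : A ⊓ B = ⊥) :
    Nonempty ((↥(A ⊔ B) ≃ₐ[K] ↥(A ⊔ B)) ≃* (A ≃ₐ[K] A) × (B ≃ₐ[K] B)) := by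
  let eA := restrictAlgEquiv (le_sup_left : A ≤ A ⊔ B)
  let eB := restrictAlgEquiv (le_sup_right : B ≤ A ⊔ B)
  have : IsGalois K (restrict (le_sup_left : A ≤ A ⊔ B)) := IsGalois.of_algEquiv eA
  have : IsGalois K (restrict (le_sup_right : B ≤ A ⊔ B)) := IsGalois.of_algEquiv eB
  have hlift : Function.Injective (lift (F := A ⊔ B) : IntermediateField K _ → _) :=
    lift_injective _
  obtain ⟨e⟩ := nonempty_gal_mulEquiv_prod (restrict (le_sup_left : A ≤ A ⊔ B))
    (restrict (le_sup_right : B ≤ A ⊔ B))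
    (hlift (by rw [lift_sup, lift_restrict, lift_restrict, lift_top]))
    (hlift (by rw [lift_inf, lift_restrict, lift_restrict, lift_bot, hinf]))
  exact ⟨e.trans (MulEquiv.prodCongr eA.autCongr.symm eB.autCongr.symm)⟩

/-- `G` is the Galois group of subextensions of `D` that are disjoint from any given finite Galois
extension. -/
def IsAmplyRealizable (D : IntermediateField K Ω) (G : Type*) [Group G] : Prop :=
  ∀ E : IntermediateField K Ω, FiniteDimensional K E → IsGalois K E →
    ∃ L ≤ D, FiniteDimensional K L ∧ IsGalois K L ∧ Nonempty ((L ≃ₐ[K] L) ≃* G) ∧ L ⊓ E = ⊥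

namespace IsAmplyRealizable

variable {D : IntermediateField K Ω}

theorem congr {G G' : Type*} [Group G] [Group G'] (e : G ≃* G') (h : IsAmplyRealizable D G) :
    IsAmplyRealizable D G' := by
  intro E hE hE'
  obtain ⟨L, hL, h1, h2, ⟨f⟩, h3⟩ := h E hE hE'
  exact ⟨L, hL, h1, h2, ⟨f.trans e⟩, h3⟩

theorem of_subsingleton (G : Type*) [Group G] [Subsingleton G] : IsAmplyRealizable D G := by
  intro E hE hE'
  refine ⟨⊥, bot_le, inferInstance, inferInstance, ⟨?_⟩, bot_inf_eq _⟩
  have : Subsingleton ((⊥ : IntermediateField K Ω) ≃ₐ[K] (⊥ : IntermediateField K Ω)) := by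
    refine (Nat.card_eq_one_iff_unique.1 ?_).1
    rw [IsGalois.card_aut_eq_finrank, IntermediateField.finrank_bot]
  exact { toFun := 1, invFun := 1, left_inv := fun _ => Subsingleton.elim _ _,
          right_inv := fun _ => Subsingleton.elim _ _, map_mul' := fun _ _ => by simp }

theorem prod {G G' : Type*} [Group G] [Group G'] (h : IsAmplyRealizable D G)
    (h' : IsAmplyRealizable D G') : IsAmplyRealizable D (G × G') := by
  intro E hE hE'
  obtain ⟨A, hA, h1, h2, ⟨f⟩, h3⟩ := h E hE hE'
  obtain ⟨B, hB, h1', h2', ⟨f'⟩, h3'⟩ := h' (A ⊔ E) inferInstance inferInstance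
  have hBA : A ⊓ B = ⊥ := by
    rw [eq_bot_iff, ← h3', inf_comm]
    exact inf_le_inf_left _ le_sup_left
  obtain ⟨e⟩ := nonempty_gal_sup_mulEquiv_prod A B hBA
  refine ⟨A ⊔ B, sup_le hA hB, inferInstance, inferInstance,
    ⟨e.trans (MulEquiv.prodCongr f f')⟩, ?_⟩
  apply LinearDisjoint.inf_eq_bot
  apply LinearDisjoint.of_finrank_sup
  rw [(IntermediateField.LinearDisjoint.of_inf_eq_bot hBA).finrank_sup, sup_right_comm, sup_comm _ B,
    (IntermediateField.LinearDisjoint.of_inf_eq_bot h3').finrank_sup,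
    (IntermediateField.LinearDisjoint.of_inf_eq_bot h3).finrank_sup]
  ring

theorem pi {ι : Type} [Finite ι] : ∀ (G : ι → Type) [∀ i, Group (G i)],
    (∀ i, IsAmplyRealizable D (G i)) → IsAmplyRealizable D (∀ i, G i) := by
  induction ι using Finite.induction_empty_option with
  | of_equiv e ih =>
    intro G _ hG
    let f : (∀ i, G i) ≃* ∀ i, G (e i) :=
      { Equiv.piCongrLeft' G e.symm with map_mul' := fun _ _ => rfl }
    exact (ih (fun i => G (e i)) fun i => hG _).congr f.symm
  | h_empty =>
    intro G _ hG
    exact of_subsingleton _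
  | h_option ih =>
    intro G _ hG
    refine ((hG none).prod (ih (fun i => G (some i)) fun i => hG _)).congr
      { (Equiv.piOptionEquivProd (β := G)).symm with map_mul' := ?_ }
    rintro ⟨a, b⟩ ⟨a', b'⟩
    funext i
    cases i <;> rfl

/-- Finite abelian groups are products of cyclic groups of prime power order. -/
theorem of_finite_commGroup
    (h : ∀ p r : ℕ, p.Prime → IsAmplyRealizable D (Multiplicative (ZMod (p ^ r))))
    (G : Type*) [CommGroup G] [Finite G] : IsAmplyRealizable D G := by
  obtain ⟨ι, _, p, hp, e, ⟨f⟩⟩ := AddCommGroup.equiv_directSum_zmod_of_finite (Additive G)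
  classical
  refine (pi (fun i => Multiplicative (ZMod (p i ^ e i))) fun i => h _ _ (hp i)).congr ?_
  let g : (∀ i, ZMod (p i ^ e i)) ≃+ Additive G :=
    (DirectSum.addEquivProd fun i => ZMod (p i ^ e i)).symm.trans f.symm
  exact
    { toFun := fun x => (g fun i => (x i).toAdd).toMul
      invFun := fun x i => Multiplicative.ofAdd (g.symm (Additive.ofMul x) i)
      left_inv := fun x => by simp
      right_inv := fun x => by simp
      map_mul' := fun x y => by
        rw [← toMul_add, ← map_add]; rfl }

end IsAmplyRealizable

end Compositum

/-! ### Descent of Kummer extensions -/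

namespace KummerDescent

open IntermediateField

variable {K M : Type*} [Field K] [Field M] [Algebra K M] {n : ℕ} [NeZero n] {ζ y : M}

theorem algEquiv_ext_of_adjoin_eq_top {s : Set M} (hs : adjoin K s = ⊤) {σ τ : M ≃ₐ[K] M}
    (h : ∀ x ∈ s, σ x = τ x) : σ = τ := by
  have h1 : (σ : M →ₐ[K] M).comp (⊤ : IntermediateField K M).val =
      (τ : M →ₐ[K] M).comp (⊤ : IntermediateField K M).val := by
    refine algHom_ext_of_eq_adjoin _ hs.symm ?_
    intro x hx
    exact h x hx
  ext x
  exact DFunLike.congr_fun h1 ⟨x, mem_top⟩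

theorem mem_fixingSubgroup_adjoin_simple_iff {x : M} {σ : M ≃ₐ[K] M} :
    σ ∈ K⟮x⟯.fixingSubgroup ↔ σ x = x := by
  constructor
  · intro h
    exact h ⟨x, mem_adjoin_simple_self K x⟩
  · intro h
    rw [← Subgroup.zpowers_le, ← le_iff_le, adjoin_simple_le_iff]
    rintro ⟨τ, hτ⟩
    exact Subgroup.zpowers_le.2 (show σ ∈ MulAction.stabilizer (M ≃ₐ[K] M) x from h) hτ

theorem exists_pow_mul_eq_of_fixes (hζ : IsPrimitiveRoot ζ n) (hy0 : y ≠ 0)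
    (hyn : y ^ n ∈ K⟮ζ⟯) {σ : M ≃ₐ[K] M} (hσ : σ ζ = ζ) : ∃ a : ℕ, σ y = ζ ^ a * y := by
  have h1 : (σ y / y) ^ n = 1 := by
    have h2 := (mem_fixingSubgroup_adjoin_simple_iff.2 hσ) ⟨_, hyn⟩
    change σ (y ^ n) = y ^ n at h2
    rw [div_pow, ← map_pow, h2, div_self (pow_ne_zero _ hy0)]
  obtain ⟨a, -, ha⟩ := hζ.eq_pow_of_pow_eq_one h1
  exact ⟨a, by rw [ha, div_mul_cancel₀ _ hy0]⟩

/-- The Kummer character of a radical. -/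
noncomputable def kummerHom (hζ : IsPrimitiveRoot ζ n) (hy0 : y ≠ 0) (hyn : y ^ n ∈ K⟮ζ⟯) :
    K⟮ζ⟯.fixingSubgroup →* M where
  toFun σ := σ.1 y / y
  map_one' := div_self hy0
  map_mul' σ τ := by
    obtain ⟨a, ha⟩ := exists_pow_mul_eq_of_fixes hζ hy0 hyn
      (mem_fixingSubgroup_adjoin_simple_iff.1 τ.2)
    change σ.1 (τ.1 y) / y = σ.1 y / y * (τ.1 y / y)
    rw [ha, map_mul, map_pow, mem_fixingSubgroup_adjoin_simple_iff.1 σ.2]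
    field_simp

variable (hζ : IsPrimitiveRoot ζ n) (hy0 : y ≠ 0) (hyn : y ^ n ∈ K⟮ζ⟯)
  (htop : adjoin K {ζ, y} = ⊤)

theorem kummerHom_apply (σ : K⟮ζ⟯.fixingSubgroup) : kummerHom hζ hy0 hyn σ = σ.1 y / y := rfl

theorem kummerHom_pow (σ : K⟮ζ⟯.fixingSubgroup) : kummerHom hζ hy0 hyn σ ^ n = 1 := by
  obtain ⟨a, ha⟩ := exists_pow_mul_eq_of_fixes hζ hy0 hyn
    (mem_fixingSubgroup_adjoin_simple_iff.1 σ.2)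
  rw [kummerHom_apply, ha, mul_div_cancel_right₀ _ hy0, ← pow_mul, mul_comm, pow_mul,
    hζ.pow_eq_one, one_pow]

include htop in
theorem kummerHom_injective : Function.Injective (kummerHom hζ hy0 hyn) := by
  intro σ τ h
  rw [kummerHom_apply, kummerHom_apply, div_left_inj' hy0] at h
  refine Subtype.ext (algEquiv_ext_of_adjoin_eq_top htop ?_)
  rintro x (rfl | rfl)
  · rw [mem_fixingSubgroup_adjoin_simple_iff.1 σ.2, mem_fixingSubgroup_adjoin_simple_iff.1 τ.2]
  · exact h

include hζ hy0 hyn htop in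
theorem card_fixingSubgroup_eq [FiniteDimensional K M] [IsGalois K M]
    (E : IntermediateField K M) (hE : ζ ∈ E) (hy : ∀ e, 0 < e → e < n → y ^ e ∉ E) :
    Nat.card E.fixingSubgroup = n := by
  have hle : E.fixingSubgroup ≤ K⟮ζ⟯.fixingSubgroup :=
    fixingSubgroup_le (adjoin_simple_le_iff.2 hE)
  let f : E.fixingSubgroup →* M := (kummerHom hζ hy0 hyn).comp (Subgroup.inclusion hle)
  have hf : Function.Injective f :=
    (kummerHom_injective hζ hy0 hyn htop).comp (Subgroup.inclusion_injective hle)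
  have hcyc : IsCyclic E.fixingSubgroup := isCyclic_of_injective_ringHom f hf
  have hdvd : Nat.card E.fixingSubgroup ∣ n := by
    rw [← IsCyclic.exponent_eq_card]
    refine Monoid.exponent_dvd_of_forall_pow_eq_one fun σ => hf ?_
    rw [map_pow, map_one]
    exact kummerHom_pow hζ hy0 hyn _
  have hmem : y ^ Nat.card E.fixingSubgroup ∈ E := by
    suffices y ^ Nat.card E.fixingSubgroup ∈ fixedField E.fixingSubgroup by
      rwa [IsGalois.fixedField_fixingSubgroup] at this
    intro σ
    have h1 : f σ ^ Nat.card E.fixingSubgroup = 1 := by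
      rw [← map_pow, pow_card_eq_one', map_one]
    have h2 : f σ = σ.1 y / y := rfl
    rw [h2, div_pow, div_eq_one_iff_eq (pow_ne_zero _ hy0), ← map_pow] at h1
    exact h1
  rcases (Nat.le_of_dvd (NeZero.pos n) hdvd).lt_or_eq with h | h
  · exact absurd hmem (hy _ Nat.card_pos h)
  · exact h

include hζ hy0 hyn htop in
theorem isGalois_adjoin_simple : IsGalois K⟮ζ⟯ M := by
  have hζ' : IsPrimitiveRoot (AdjoinSimple.gen K ζ) n :=
    IsPrimitiveRoot.of_map_of_injective (f := algebraMap K⟮ζ⟯ M) (by simpa using hζ)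
      (algebraMap K⟮ζ⟯ M).injective
  have hn : ((n : ℕ) : K⟮ζ⟯) ≠ 0 := (hζ'.neZero').out
  have ha : (⟨y ^ n, hyn⟩ : K⟮ζ⟯) ≠ 0 := fun h => pow_ne_zero n hy0 (congrArg Subtype.val h)
  have hsep := Polynomial.separable_X_pow_sub_C _ hn ha
  have : Polynomial.IsSplittingField K⟮ζ⟯ M (Polynomial.X ^ n - Polynomial.C ⟨y ^ n, hyn⟩) := by
    refine isSplittingField_iff_intermediateField.2 ⟨?_, ?_⟩
    · simpa using X_pow_sub_C_splits_of_isPrimitiveRoot hζ (rfl : y ^ n = y ^ n)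
    · rw [← restrictScalars_eq_top_iff (K := K), restrictScalars_adjoin, eq_top_iff, ← htop]
      refine adjoin_le_iff.2 ?_
      rintro x (rfl | rfl)
      · exact subset_adjoin _ _ (Or.inl (mem_adjoin_simple_self K _))
      · refine subset_adjoin _ _ (Or.inr ?_)
        rw [Polynomial.mem_rootSet]
        refine ⟨hsep.ne_zero, ?_⟩
        simp
  exact IsGalois.of_separable_splitting_field hsep

variable (Γ : Subgroup (M ≃ₐ[K] M))
  (hΓ : ∀ γ ∈ Γ, ∃ c : ℕ, γ ζ = ζ ^ c ∧ ∃ g ∈ K⟮ζ⟯, γ y = y ^ c * g)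
  (hΓ' : ∀ γ ∈ Γ, γ ζ = ζ → γ y = y) (hfix : fixedField Γ ⊓ K⟮ζ⟯ = ⊥)

include hζ hy0 hyn htop hfix in
theorem isGalois [FiniteDimensional K M] : IsGalois K M := by
  have := isGalois_adjoin_simple hζ hy0 hyn htop
  refine IsGalois.of_fixedField_eq_bot K M ?_
  rw [eq_bot_iff, ← hfix]
  intro x hx
  refine ⟨fun γ => hx ⟨γ.1, trivial⟩, ?_⟩
  have h1 : x ∈ (⊥ : IntermediateField K⟮ζ⟯ M) := by
    refine (IsGalois.mem_bot_iff_fixed x).2 fun σ => ?_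
    exact hx ⟨σ.restrictScalars K, trivial⟩
  obtain ⟨z, rfl⟩ := mem_bot.1 h1
  exact z.2

include hζ hy0 hyn htop hΓ in
theorem commute {σ γ : M ≃ₐ[K] M} (hσ : σ ∈ K⟮ζ⟯.fixingSubgroup) (hγ : γ ∈ Γ) :
    σ * γ = γ * σ := by
  obtain ⟨c, h1, g, hg, h2⟩ := hΓ γ hγ
  have hσζ := mem_fixingSubgroup_adjoin_simple_iff.1 hσ
  obtain ⟨a, ha⟩ := exists_pow_mul_eq_of_fixes hζ hy0 hyn hσζ
  have hσg : σ g = g := hσ ⟨g, hg⟩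
  refine algEquiv_ext_of_adjoin_eq_top htop ?_
  rintro x (rfl | rfl)
  · simp [hσζ, h1]
  · simp only [AlgEquiv.mul_apply, h2, ha, map_mul, map_pow, hσg, h1]
    ring

include hζ hy0 hyn htop hΓ hΓ' hfix in
/-- A Kummer extension of a cyclotomic extension of `K` descends to a cyclic extension of `K`. -/
theorem descent [FiniteDimensional K M] (E : IntermediateField K M) (hE : ζ ∈ E)
    (hy : ∀ e, 0 < e → e < n → y ^ e ∉ E) :
    IsGalois K (fixedField Γ) ∧
    Nonempty ((fixedField Γ ≃ₐ[K] fixedField Γ) ≃* Multiplicative (ZMod n)) ∧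
    fixedField Γ ⊓ E = ⊥ := by
  have hG : IsGalois K M := isGalois hζ hy0 hyn htop Γ hfix
  have hle : K⟮ζ⟯ ≤ E := adjoin_simple_le_iff.2 hE
  have hcardE := card_fixingSubgroup_eq hζ hy0 hyn htop E hE hy
  have hcard := card_fixingSubgroup_eq hζ hy0 hyn htop K⟮ζ⟯ (mem_adjoin_simple_self K ζ)
    fun e h1 h2 h3 => hy e h1 h2 (hle h3)
  have hEζ : K⟮ζ⟯ = E := by
    have h1 : E.fixingSubgroup = K⟮ζ⟯.fixingSubgroup :=
      Subgroup.eq_of_le_of_card_ge (fixingSubgroup_le hle) (by rw [hcard, hcardE])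
    rw [← IsGalois.fixedField_fixingSubgroup E, h1, IsGalois.fixedField_fixingSubgroup]
  set N := K⟮ζ⟯.fixingSubgroup with hN
  have hcyc : IsCyclic N := isCyclic_of_injective_ringHom _ (kummerHom_injective hζ hy0 hyn htop)
  have hdisj : Disjoint N Γ := by
    rw [Subgroup.disjoint_def]
    intro σ h1 h2
    have hσζ := mem_fixingSubgroup_adjoin_simple_iff.1 h1
    refine algEquiv_ext_of_adjoin_eq_top htop ?_
    rintro x (rfl | rfl)
    · exact hσζ
    · exact hΓ' σ h2 hσζ
  have hsup : N ⊔ Γ = ⊤ := by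
    have h1 : fixedField (N ⊔ Γ) = ⊥ := by
      rw [eq_bot_iff, ← hfix]
      refine le_inf (fixedField_le le_sup_right) ((fixedField_le le_sup_left).trans ?_)
      rw [hN, IsGalois.fixedField_fixingSubgroup]
    rw [← fixingSubgroup_fixedField (N ⊔ Γ), h1, fixingSubgroup_bot]
  have hnormal : Γ.Normal := by
    rw [← Subgroup.normalizer_eq_top_iff, eq_top_iff, ← hsup]
    refine sup_le ?_ Subgroup.le_normalizer
    intro σ hσ
    rw [Subgroup.mem_normalizer_iff]
    intro γ
    constructor
    · intro hγ
      rwa [commute hζ hy0 hyn htop Γ hΓ hσ hγ, mul_inv_cancel_right]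
    · intro hγ
      have h1 := commute hζ hy0 hyn htop Γ hΓ (inv_mem hσ) hγ
      have h2 : γ = σ⁻¹ * (σ * γ * σ⁻¹) * σ := by group
      rw [h2, h1, inv_mul_cancel_right]
      exact hγ
  have hcompl : Subgroup.IsComplement' N Γ := by
    refine Subgroup.isComplement'_of_disjoint_and_mul_eq_univ hdisj ?_
    rw [← Subgroup.mul_normal, hsup, Subgroup.coe_top]
  refine ⟨inferInstance, ⟨?_⟩, hEζ ▸ hfix⟩
  exact (IsGalois.normalAutEquivQuotient Γ).symm.trans (hcompl.QuotientMulEquiv.trans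
    (hcard ▸ (zmodCyclicMulEquiv hcyc).symm))

/-- Restrictions of automorphisms of `Ω` to an intermediate field. -/
def restrictionSubgroup {K Ω : Type*} [Field K] [Field Ω] [Algebra K Ω]
    (Γ : Subgroup (Ω ≃ₐ[K] Ω)) (M : IntermediateField K Ω) : Subgroup (M ≃ₐ[K] M) where
  carrier := {τ | ∃ γ ∈ Γ, ∀ x : M, (τ x : Ω) = γ x}
  one_mem' := ⟨1, one_mem _, fun _ => rfl⟩
  mul_mem' := by
    rintro σ τ ⟨γ, hγ, h1⟩ ⟨δ, hδ, h2⟩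
    exact ⟨γ * δ, mul_mem hγ hδ, fun x => by
      rw [AlgEquiv.mul_apply, AlgEquiv.mul_apply, h1, h2]⟩
  inv_mem' := by
    rintro σ ⟨γ, hγ, h1⟩
    refine ⟨γ⁻¹, inv_mem hγ, fun x => ?_⟩
    apply γ.injective
    rw [← h1]
    change ((σ (σ.symm x) : M) : Ω) = γ (γ.symm x)
    simp

variable {K Ω : Type*} [Field K] [Field Ω] [Algebra K Ω] {n : ℕ} [NeZero n] {ζ y : Ω}

/-- A Kummer extension of a cyclotomic extension of `K` descends to a cyclic extension of `K`. -/
theorem exists_cyclic (hζ : IsPrimitiveRoot ζ n) (hζK : IsIntegral K ζ)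
    (hy0 : y ≠ 0) (hyn : y ^ n ∈ K⟮ζ⟯) (Γ : Subgroup (Ω ≃ₐ[K] Ω))
    (hΓ : ∀ γ ∈ Γ, ∃ c : ℕ, γ ζ = ζ ^ c ∧ ∃ g ∈ K⟮ζ⟯, γ y = y ^ c * g)
    (hΓ' : ∀ γ ∈ Γ, γ ζ = ζ → γ y = y) (hfix : fixedField Γ ⊓ K⟮ζ⟯ = ⊥)
    (E : IntermediateField K Ω) (hy : ∀ e, 0 < e → e < n → y ^ e ∉ E ⊔ K⟮ζ⟯) :
    ∃ L ≤ fixedField Γ, FiniteDimensional K L ∧ IsGalois K L ∧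
      Nonempty ((L ≃ₐ[K] L) ≃* Multiplicative (ZMod n)) ∧ L ⊓ E = ⊥ := by
  have hyK : IsIntegral K y := by
    refine IsIntegral.of_pow (NeZero.pos n) ?_
    have : FiniteDimensional K K⟮ζ⟯ := adjoin.finiteDimensional hζK
    exact (isIntegral_iff (S := K⟮ζ⟯) (x := ⟨_, hyn⟩)).1 (IsIntegral.of_finite K _)
  set M : IntermediateField K Ω := adjoin K {ζ, y} with hM
  have hfin : FiniteDimensional K M := by
    refine finiteDimensional_adjoin ?_
    rintro x (rfl | rfl)
    · exact hζK
    · exact hyK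
  have hζM : ζ ∈ M := subset_adjoin _ _ (Or.inl rfl)
  have hyM : y ∈ M := subset_adjoin _ _ (Or.inr rfl)
  have hKM : K⟮ζ⟯ ≤ M := adjoin_simple_le_iff.2 hζM
  set ζ' : M := ⟨ζ, hζM⟩
  set y' : M := ⟨y, hyM⟩
  have hζ' : IsPrimitiveRoot ζ' n :=
    IsPrimitiveRoot.of_map_of_injective (f := algebraMap M Ω) hζ (algebraMap M Ω).injective
  have hmem : ∀ x : M, x ∈ K⟮ζ'⟯ ↔ (x : Ω) ∈ K⟮ζ⟯ := by
    intro x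
    rw [← mem_lift, lift_adjoin_simple]
  have htop : adjoin K {ζ', y'} = ⊤ := by
    apply lift_injective M
    rw [lift_adjoin, lift_top, Set.image_pair]
  have hext : ∀ γ ∈ Γ, ∃ τ ∈ restrictionSubgroup Γ M, ∀ x : M, (τ x : Ω) = γ x := by
    intro γ hγ
    have hle : M ≤ M.comap (γ : Ω →ₐ[K] Ω) := by
      refine adjoin_le_iff.2 ?_
      obtain ⟨c, h1, g, hg, h2⟩ := hΓ γ hγ
      rintro x (rfl | rfl)
      · change γ x ∈ M
        rw [h1]
        exact pow_mem hζM c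
      · change γ x ∈ M
        rw [h2]
        exact mul_mem (pow_mem hyM c) (hKM hg)
    let f : M →ₐ[K] M := ((γ : Ω →ₐ[K] Ω).comp M.val).codRestrict M.toSubalgebra fun x => hle x.2
    let τ : M ≃ₐ[K] M := AlgEquiv.ofBijective f f.bijective
    exact ⟨τ, ⟨γ, hγ, fun x => rfl⟩, fun x => rfl⟩
  have hfixed : ∀ x : M, x ∈ fixedField (restrictionSubgroup Γ M) ↔ (x : Ω) ∈ fixedField Γ := by
    intro x
    constructor
    · rintro hx ⟨γ, hγ⟩
      obtain ⟨τ, hτ, h⟩ := hext γ hγ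
      exact (h x).symm.trans (congrArg Subtype.val (hx ⟨τ, hτ⟩))
    · rintro hx ⟨τ, γ, hγ, h⟩
      exact Subtype.ext ((h x).trans (hx ⟨γ, hγ⟩))
  have hbot : ∀ x : M, x ∈ (⊥ : IntermediateField K M) ↔ (x : Ω) ∈ (⊥ : IntermediateField K Ω) := by
    intro x
    rw [← mem_lift, lift_bot]
  obtain ⟨hG, ⟨e⟩, hinf⟩ := descent hζ' (y := y') (fun h => hy0 (congrArg Subtype.val h))
    ((hmem _).2 hyn) htop (restrictionSubgroup Γ M)
    (by
      rintro τ ⟨γ, hγ, h⟩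
      obtain ⟨c, h1, g, hg, h2⟩ := hΓ γ hγ
      exact ⟨c, Subtype.ext ((h _).trans h1), ⟨g, hKM hg⟩, (hmem _).2 hg,
        Subtype.ext ((h _).trans h2)⟩)
    (by
      rintro τ ⟨γ, hγ, h⟩ h1
      exact Subtype.ext ((h _).trans (hΓ' γ hγ ((h _).symm.trans (congrArg Subtype.val h1)))))
    (by
      rw [eq_bot_iff]
      rintro x ⟨h1, h2⟩
      rw [hbot, ← hfix]
      exact ⟨(hfixed x).1 h1, (hmem x).1 h2⟩)
    ((E ⊔ K⟮ζ⟯).comap M.val) (le_sup_right (a := E) (mem_adjoin_simple_self K ζ))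
    (fun e h1 h2 => hy e h1 h2)
  refine ⟨lift (fixedField (restrictionSubgroup Γ M)), ?_,
    (liftAlgEquiv _).toLinearEquiv.finiteDimensional, IsGalois.of_algEquiv (liftAlgEquiv _), ⟨(liftAlgEquiv _).autCongr.symm.trans e⟩, ?_⟩
  · intro x hx
    have hxM : x ∈ M := lift_le _ hx
    exact (hfixed ⟨x, hxM⟩).1 ((mem_lift (F := M) ⟨x, hxM⟩).1 hx)
  · rw [eq_bot_iff]
    rintro x ⟨hx, hxE⟩
    have hxM : x ∈ M := lift_le _ hx
    refine (hbot ⟨x, hxM⟩).1 ?_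
    rw [← hinf]
    exact ⟨(mem_lift (F := M) ⟨x, hxM⟩).1 hx, le_sup_left (a := E) hxE⟩

end KummerDescent

/-! ### Cyclic extensions of degree prime to the characteristic -/

namespace SeriesExpansion

section TamePolynomial

open Polynomial

variable {S : Type*} [Field S] {n : ℕ} [NeZero n] {ζ : S}

omit [NeZero n] in
theorem pow_val_mul (hζ : IsPrimitiveRoot ζ n) (c s : ZMod n) :
    ζ ^ (c * s).val = (ζ ^ c.val) ^ s.val := by
  rw [ZMod.val_mul, ← pow_mul, ← pow_mod_orderOf ζ (c.val * s.val), ← hζ.eq_orderOf]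

theorem pow_val_injective (hζ : IsPrimitiveRoot ζ n) :
    Function.Injective fun s : ZMod n => ζ ^ s.val := by
  intro s t h
  exact ZMod.val_injective n (hζ.pow_inj (ZMod.val_lt s) (ZMod.val_lt t) h)

/-- The linear polynomial `1 - b X`. -/
noncomputable def linFactor (b : S) : S[X] := 1 - C b * X

theorem constantCoeff_linFactor (b : S) : constantCoeff (linFactor b) = 1 := by
  simp [linFactor]

variable (n ζ) in
/-- A product of conjugate linear factors, on which automorphisms of the coefficients act through
the cyclotomic character up to `n`-th powers. -/
noncomputable def tamePoly (a : S) : S[X] :=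
  ∏ s : (ZMod n)ˣ, linFactor (ζ ^ (s : ZMod n).val + a) ^ ((s⁻¹ : (ZMod n)ˣ) : ZMod n).val

theorem constantCoeff_tamePoly (a : S) : constantCoeff (tamePoly n ζ a) = 1 := by
  simp only [tamePoly, map_prod, map_pow, constantCoeff_linFactor, one_pow, Finset.prod_const_one]

theorem map_linFactor {T : Type*} [Field T] (γ : S →+* T) (b : S) :
    (linFactor b).map γ = linFactor (γ b) := by
  simp [linFactor]

theorem map_tamePoly_of_fixes (γ : S →+* S) (hγ : γ ζ = ζ) {a : S} (ha : γ a = a) :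
    (tamePoly n ζ a).map γ = tamePoly n ζ a := by
  simp [tamePoly, Polynomial.map_prod, map_linFactor, hγ, ha]

theorem tamePoly_pow (hζ : IsPrimitiveRoot ζ n) (γ : S →+* S) (c : (ZMod n)ˣ)
    (hγ : γ ζ = ζ ^ (c : ZMod n).val) {a : S} (ha : γ a = a) :
    ∃ q : (ZMod n)ˣ → ℕ, tamePoly n ζ a ^ (c : ZMod n).val = (tamePoly n ζ a).map γ *
      (∏ s : (ZMod n)ˣ, linFactor (ζ ^ (s : ZMod n).val + a) ^ q s) ^ n := by
  refine ⟨fun s => (c : ZMod n).val * ((s⁻¹ : (ZMod n)ˣ) : ZMod n).val / n, ?_⟩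
  have h1 : (tamePoly n ζ a).map γ = ∏ s : (ZMod n)ˣ,
      linFactor (ζ ^ (s : ZMod n).val + a) ^ ((c * s⁻¹ : (ZMod n)ˣ) : ZMod n).val := by
    rw [tamePoly, Polynomial.map_prod]
    refine Fintype.prod_equiv (Equiv.mulLeft c) _ _ fun s => ?_
    simp only [Polynomial.map_pow, map_linFactor, map_add, map_pow, hγ, ha, Equiv.coe_mulLeft,
      Units.val_mul, pow_val_mul hζ, mul_inv_rev, mul_inv_cancel_comm_assoc]
  rw [h1, tamePoly, ← Finset.prod_pow, ← Finset.prod_pow, ← Finset.prod_mul_distrib]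
  refine Finset.prod_congr rfl fun s _ => ?_
  rw [← pow_mul, ← pow_mul, ← pow_add]
  congr 1
  rw [Units.val_mul, ZMod.val_mul, mul_comm _ n, Nat.mod_add_div, mul_comm]

theorem rootMultiplicity_linFactor {b : S} (hb : b ≠ 0) :
    (linFactor b).rootMultiplicity b⁻¹ = 1 := by
  have : linFactor b = C (-b) * (X - C b⁻¹) := by
    rw [mul_sub, ← C_mul, linFactor]
    simp [hb]
    ring
  rw [this, rootMultiplicity_mul (mul_ne_zero (by simpa using hb) (X_sub_C_ne_zero _)),
    rootMultiplicity_C, rootMultiplicity_X_sub_C_self]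

theorem linFactor_ne_zero (b : S) : linFactor b ≠ 0 := by
  intro h
  have := constantCoeff_linFactor b
  simp [h] at this

theorem tamePoly_ne_zero (a : S) : tamePoly n ζ a ≠ 0 :=
  Finset.prod_ne_zero_iff.2 fun _ _ => pow_ne_zero _ (linFactor_ne_zero _)

theorem rootMultiplicity_tamePoly_self (hn : 1 < n) (hζ : IsPrimitiveRoot ζ n) {a : S}
    (ha : ζ + a ≠ 0) : (tamePoly n ζ a).rootMultiplicity (ζ + a)⁻¹ = 1 := by
  classical
  have hn' : Fact (1 < n) := ⟨hn⟩
  have h1 : tamePoly n ζ a = linFactor (ζ + a) * ∏ s ∈ Finset.univ.erase (1 : (ZMod n)ˣ),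
      linFactor (ζ ^ (s : ZMod n).val + a) ^ ((s⁻¹ : (ZMod n)ˣ) : ZMod n).val := by
    rw [tamePoly, ← Finset.mul_prod_erase _ _ (Finset.mem_univ 1)]
    simp [ZMod.val_one]
  have h2 : (∏ s ∈ Finset.univ.erase (1 : (ZMod n)ˣ),
      linFactor (ζ ^ (s : ZMod n).val + a) ^ ((s⁻¹ : (ZMod n)ˣ) : ZMod n).val).rootMultiplicity
        (ζ + a)⁻¹ = 0 := by
    refine rootMultiplicity_eq_zero ?_
    rw [IsRoot.def, eval_prod, Finset.prod_eq_zero_iff]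
    rintro ⟨s, hs, h⟩
    rw [eval_pow] at h
    have h3 := eq_zero_of_pow_eq_zero h
    simp only [linFactor, eval_sub, eval_one, eval_mul, eval_C, eval_X, sub_eq_zero] at h3
    rw [eq_comm, mul_inv_eq_one₀ ha, add_left_inj] at h3
    refine (Finset.mem_erase.1 hs).1 (Units.ext (pow_val_injective hζ ?_))
    simpa [ZMod.val_one] using h3
  have h0 := tamePoly_ne_zero (n := n) (ζ := ζ) a
  rw [h1] at h0 ⊢
  rw [rootMultiplicity_mul h0, h2, rootMultiplicity_linFactor ha]

theorem rootMultiplicity_tamePoly_of_forall_ne {a b : S} (ha : ζ + a ≠ 0)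
    (hb : ∀ s : (ZMod n)ˣ, ζ ^ (s : ZMod n).val + b ≠ ζ + a) :
    (tamePoly n ζ b).rootMultiplicity (ζ + a)⁻¹ = 0 := by
  refine rootMultiplicity_eq_zero ?_
  rw [IsRoot.def, tamePoly, eval_prod, Finset.prod_eq_zero_iff]
  rintro ⟨s, -, h⟩
  rw [eval_pow] at h
  have h3 := eq_zero_of_pow_eq_zero h
  simp only [linFactor, eval_sub, eval_one, eval_mul, eval_C, eval_X, sub_eq_zero] at h3
  rw [eq_comm, mul_inv_eq_one₀ ha] at h3
  exact hb s h3

theorem pow_mul_tamePoly_pow_ne (hn : 1 < n) (hζ : IsPrimitiveRoot ζ n) {a b : S}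
    (ha : ζ + a ≠ 0) (hb : ∀ s : (ZMod n)ˣ, ζ ^ (s : ZMod n).val + b ≠ ζ + a)
    {e : ℕ} (he : 0 < e) (hen : e < n) {P Q : S[X]} (hQ : Q ≠ 0) :
    Q ^ n * tamePoly n ζ a ^ e ≠ P ^ n * tamePoly n ζ b ^ e := by
  classical
  intro h
  have h0 : Q ^ n * tamePoly n ζ a ^ e ≠ 0 :=
    mul_ne_zero (pow_ne_zero _ hQ) (pow_ne_zero _ (tamePoly_ne_zero a))
  have h1 := congrArg (rootMultiplicity (ζ + a)⁻¹) h
  rw [rootMultiplicity_mul h0, rootMultiplicity_mul (h ▸ h0)] at h1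
  simp only [← count_roots, roots_pow, Multiset.count_nsmul] at h1
  simp only [count_roots, rootMultiplicity_tamePoly_self hn hζ ha,
    rootMultiplicity_tamePoly_of_forall_ne ha hb] at h1
  have h2 : n ∣ n * rootMultiplicity (ζ + a)⁻¹ Q + e * 1 := ⟨rootMultiplicity (ζ + a)⁻¹ P, by rw [h1]; ring⟩
  rw [Nat.dvd_add_right (dvd_mul_right _ _), mul_one] at h2
  exact absurd (Nat.le_of_dvd he h2) (not_le.2 hen)

end TamePolynomial

end SeriesExpansion

namespace KummerDescent

open IntermediateField

variable {K Ω : Type*} [Field K] [Field Ω] [Algebra K Ω] {n : ℕ} [NeZero n] {ζ : Ω}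

theorem isGalois_adjoin_primitiveRoot (hζ : IsPrimitiveRoot ζ n) (hζK : IsIntegral K ζ) :
    IsGalois K K⟮ζ⟯ := by
  have h : IsCyclotomicExtension {n} K K⟮ζ⟯ := by
    change IsCyclotomicExtension {n} K K⟮ζ⟯.toSubalgebra
    rw [adjoin_simple_toSubalgebra_of_isAlgebraic hζK.isAlgebraic]
    exact hζ.adjoin_isCyclotomicExtension K
  exact IsCyclotomicExtension.isGalois {n} K K⟮ζ⟯

/-- Radicals in a finite Galois extension fall into finitely many classes. -/
theorem exists_infinite_div_mem (hζ : IsPrimitiveRoot ζ n) (E : IntermediateField K Ω)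
    [FiniteDimensional K E] [IsGalois K E] (hζE : ζ ∈ E) {ι : Type*} [Infinite ι] (w : ι → Ω)
    (hw0 : ∀ i, w i ≠ 0) (hwE : ∀ i, w i ∈ E) (hwn : ∀ i, w i ^ n ∈ K⟮ζ⟯) :
    ∃ A : Set ι, A.Infinite ∧ ∀ i ∈ A, ∀ j ∈ A, w i / w j ∈ K⟮ζ⟯ := by
  set ζ' : E := ⟨ζ, hζE⟩
  let w' : ι → E := fun i => ⟨w i, hwE i⟩
  have hw0' : ∀ i, w' i ≠ 0 := fun i h => hw0 i (congrArg Subtype.val h)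
  have hζ' : IsPrimitiveRoot ζ' n :=
    IsPrimitiveRoot.of_map_of_injective (f := algebraMap E Ω) hζ (algebraMap E Ω).injective
  have hmem : ∀ x : E, x ∈ K⟮ζ'⟯ ↔ (x : Ω) ∈ K⟮ζ⟯ := by
    intro x
    rw [← mem_lift, lift_adjoin_simple]
  have h1 : ∀ i (σ : K⟮ζ'⟯.fixingSubgroup), ∃ a : Fin n, σ.1 (w' i) = ζ' ^ (a : ℕ) * w' i := by
    intro i σ
    obtain ⟨a, ha⟩ := exists_pow_mul_eq_of_fixes hζ' (hw0' i) ((hmem _).2 (hwn i))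
      (mem_fixingSubgroup_adjoin_simple_iff.1 σ.2)
    refine ⟨⟨a % n, Nat.mod_lt _ (NeZero.pos n)⟩, ?_⟩
    rw [ha]
    change _ = ζ' ^ (a % n) * w' i
    rw [hζ'.eq_orderOf, pow_mod_orderOf]
  choose a ha using h1
  obtain ⟨f, hf⟩ := Finite.exists_infinite_fiber a
  refine ⟨a ⁻¹' {f}, Set.infinite_coe_iff.1 hf, fun i hi j hj => ?_⟩
  refine (hmem (w' i / w' j)).1 ?_
  rw [← IsGalois.fixedField_fixingSubgroup K⟮ζ'⟯]
  rintro σ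
  change σ.1 (w' i / w' j) = _
  rw [map_div₀, ha, ha, show a i = a j from hi.trans hj.symm,
    mul_div_mul_left _ _ (pow_ne_zero _ (hζ'.ne_zero (NeZero.ne n)))]

end KummerDescent

namespace SeriesExpansion

open Polynomial IntermediateField

variable (k S K Ω : Type*) [Field k] [Field S] [Field K] [Field Ω] [Algebra k S]
  [Algebra k[X] K] [Algebra (PowerSeries S) Ω] [Algebra K Ω]
  [IsFractionRing (PowerSeries S) Ω] [IsFractionRing k[X] K]
  [IsSeriesExpansion k S K Ω]

omit [IsFractionRing k[X] K] [IsFractionRing (PowerSeries S) Ω] in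
theorem algebraMap_C (a : k) : algebraMap K Ω (algebraMap k[X] K (C a)) =
    algebraMap (PowerSeries S) Ω (PowerSeries.C (algebraMap k S a)) := by
  rw [IsSeriesExpansion.algebraMap_polynomial (S := S)]
  simp

omit [IsFractionRing k[X] K] [IsFractionRing (PowerSeries S) Ω] in
theorem algebraMap_X : algebraMap K Ω (algebraMap k[X] K X) =
    algebraMap (PowerSeries S) Ω PowerSeries.X := by
  rw [IsSeriesExpansion.algebraMap_polynomial (S := S)]
  simp

variable {n : ℕ} [NeZero n] {ζ : S}

omit [NeZero n] in
theorem isPrimitiveRoot_algebraMap_C (hζ : IsPrimitiveRoot ζ n) :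
    IsPrimitiveRoot (algebraMap (PowerSeries S) Ω (PowerSeries.C ζ)) n :=
  (hζ.map_of_injective (PowerSeries.C_injective)).map_of_injective
    (IsFractionRing.injective (PowerSeries S) Ω)

theorem isIntegral_algebraMap_C (hζ : IsPrimitiveRoot ζ n) :
    IsIntegral K (algebraMap (PowerSeries S) Ω (PowerSeries.C ζ)) :=
  ((isPrimitiveRoot_algebraMap_C S Ω hζ).isIntegral (NeZero.pos n)).tower_top

theorem invariantSeries_inf_adjoin [IsGalois k S] (hζ : IsPrimitiveRoot ζ n) :
    invariantSeries k S K Ω ⊓ K⟮algebraMap (PowerSeries S) Ω (PowerSeries.C ζ)⟯ = ⊥ := by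
  set z := algebraMap (PowerSeries S) Ω (PowerSeries.C ζ) with hz
  have hzn := isPrimitiveRoot_algebraMap_C S Ω hζ
  have hzK := isIntegral_algebraMap_C S K Ω hζ
  have hG := KummerDescent.isGalois_adjoin_primitiveRoot (K := K) hzn hzK
  rw [eq_bot_iff]
  rintro x ⟨hx, hx'⟩
  have : FiniteDimensional K K⟮z⟯ := adjoin.finiteDimensional hzK
  have key : (⟨x, hx'⟩ : K⟮z⟯) ∈ (⊥ : IntermediateField K K⟮z⟯) := by
    rw [IsGalois.mem_bot_iff_fixed]
    intro τ
    have h1 : (AdjoinSimple.gen K z) ^ n = 1 := Subtype.ext hzn.pow_eq_one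
    have h2 : ((τ (AdjoinSimple.gen K z) : K⟮z⟯) : Ω) ^ n = 1 := by
      have := congrArg τ h1
      rw [map_pow, map_one] at this
      exact congrArg Subtype.val this
    obtain ⟨j, -, hj⟩ := hzn.eq_pow_of_pow_eq_one h2
    have h3 : aeval (ζ ^ j) (minpoly k ζ) = 0 := by
      have hcomp : ((algebraMap K Ω).comp ((algebraMap k[X] K).comp C)) =
          ((algebraMap (PowerSeries S) Ω).comp PowerSeries.C).comp (algebraMap k S) :=
        RingHom.ext fun a => algebraMap_C k S K Ω a
      apply ((algebraMap (PowerSeries S) Ω).comp PowerSeries.C).injective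
      rw [map_zero, aeval_def, hom_eval₂, ← hcomp, map_pow]
      change eval₂ _ (z ^ j) _ = 0
      rw [hj]
      let g : K⟮z⟯ →+* Ω := (K⟮z⟯.val.comp τ.toAlgHom).toRingHom
      have h4 : eval₂ ((algebraMap K K⟮z⟯).comp ((algebraMap k[X] K).comp C))
          (AdjoinSimple.gen K z) (minpoly k ζ) = 0 := by
        apply K⟮z⟯.val.toRingHom.injective
        rw [map_zero, hom_eval₂]
        have h5 := congrArg ((algebraMap (PowerSeries S) Ω).comp PowerSeries.C) (minpoly.aeval k ζ)
        rw [map_zero, aeval_def, hom_eval₂, ← hcomp] at h5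
        exact h5
      have h6 := congrArg g h4
      rw [map_zero, hom_eval₂] at h6
      convert! h6 using 2
      ext a
      exact (congrArg Subtype.val (τ.commutes (algebraMap k[X] K (C a)))).symm
    obtain ⟨γ, hγ⟩ := minpoly.exists_algEquiv_of_root'
      (Algebra.IsAlgebraic.isAlgebraic ζ) h3
    have h4 : seriesAut k S K Ω γ z = z ^ j := by
      rw [hz, seriesAut_algebraMap, PowerSeries.map_C, ← map_pow, ← map_pow]
      exact congrArg _ (congrArg _ hγ)
    have h5 : ((seriesAut k S K Ω γ : Ω →ₐ[K] Ω).comp K⟮z⟯.val) = K⟮z⟯.val.comp τ.toAlgHom := by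
      refine IntermediateField.algHom_ext_of_eq_adjoin _ rfl ?_
      rintro _ ⟨⟩
      exact h4.trans hj
    apply Subtype.ext
    have h6 := DFunLike.congr_fun h5 ⟨x, hx'⟩
    exact h6.symm.trans ((mem_invariantSeries_iff k S K Ω x).1 hx γ)
  obtain ⟨c, hc⟩ := key
  exact ⟨c, congrArg Subtype.val hc⟩

end SeriesExpansion

namespace SeriesExpansion

open Polynomial IntermediateField

variable (k S K Ω : Type*) [Field k] [Field S] [Field K] [Field Ω] [Algebra k S]
  [Algebra k[X] K] [Algebra (PowerSeries S) Ω] [Algebra K Ω]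
  [IsFractionRing (PowerSeries S) Ω] [IsFractionRing k[X] K]
  [IsSeriesExpansion k S K Ω]

/-- Expansion of polynomials over `S` as Laurent series. -/
noncomputable def polynomialToSeries : S[X] →+* Ω :=
  (algebraMap (PowerSeries S) Ω).comp Polynomial.coeToPowerSeries.ringHom

omit [IsFractionRing (PowerSeries S) Ω] in
theorem polynomialToSeries_apply (P : S[X]) :
    polynomialToSeries S Ω P = algebraMap (PowerSeries S) Ω P := rfl

theorem polynomialToSeries_injective : Function.Injective (polynomialToSeries S Ω) :=
  (IsFractionRing.injective (PowerSeries S) Ω).comp (Polynomial.coe_injective S)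

include k in
theorem exists_mul_eq_of_mem_adjoin (ζ : S) {x : Ω}
    (hx : x ∈ K⟮algebraMap (PowerSeries S) Ω (PowerSeries.C ζ)⟯) :
    ∃ P Q : S[X], Q ≠ 0 ∧ x * polynomialToSeries S Ω Q = polynomialToSeries S Ω P := by
  let f : FractionRing S[X] →+* Ω := IsFractionRing.lift (polynomialToSeries_injective S Ω)
  have hf : ∀ P : S[X], f (algebraMap _ _ P) = polynomialToSeries S Ω P :=
    IsFractionRing.lift_algebraMap (polynomialToSeries_injective S Ω)
  have hx' : x ∈ f.fieldRange := by
    refine adjoin_le_subfield K _ (K := f.fieldRange) ?_ ?_ hx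
    · rintro _ ⟨c, rfl⟩
      obtain ⟨P, Q, hQ, rfl⟩ := IsFractionRing.div_surjective (A := k[X]) c
      refine ⟨algebraMap _ _ (P.map (algebraMap k S)) / algebraMap _ _ (Q.map (algebraMap k S)), ?_⟩
      simp only [map_div₀, hf, IsSeriesExpansion.algebraMap_polynomial (S := S),
        polynomialToSeries_apply]
    · rintro _ rfl
      refine ⟨algebraMap _ _ (C ζ), ?_⟩
      rw [hf, polynomialToSeries_apply, Polynomial.coe_C]
  obtain ⟨r, rfl⟩ := hx'
  obtain ⟨P, Q, hQ, rfl⟩ := IsFractionRing.div_surjective (A := S[X]) r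
  have hQ0 : Q ≠ 0 := nonZeroDivisors.ne_zero hQ
  refine ⟨P, Q, hQ0, ?_⟩
  rw [map_div₀, hf, hf, div_mul_cancel₀]
  exact (map_ne_zero_iff _ (polynomialToSeries_injective S Ω)).2 hQ0

omit [IsFractionRing (PowerSeries S) Ω] [IsFractionRing k[X] K] in
theorem linFactor_mem_adjoin (ζ : S) (a : k) (j : ℕ) :
    polynomialToSeries S Ω (linFactor (ζ ^ j + algebraMap k S a)) ∈
      K⟮algebraMap (PowerSeries S) Ω (PowerSeries.C ζ)⟯ := by
  rw [linFactor, map_sub, map_one, map_mul]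
  refine sub_mem (one_mem _) (mul_mem ?_ ?_)
  · rw [polynomialToSeries_apply, Polynomial.coe_C, map_add, map_add, map_pow, map_pow,
      ← algebraMap_C k S K Ω]
    exact add_mem (pow_mem (mem_adjoin_simple_self _ _) _) (_root_.algebraMap_mem _ _)
  · rw [polynomialToSeries_apply, Polynomial.coe_X, ← algebraMap_X k S K Ω]
    exact _root_.algebraMap_mem _ _

variable {n : ℕ} [NeZero n] {ζ : S}

omit [IsFractionRing (PowerSeries S) Ω] [IsFractionRing k[X] K] in
theorem tamePoly_mem_adjoin (a : k) : polynomialToSeries S Ω (tamePoly n ζ (algebraMap k S a)) ∈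
    K⟮algebraMap (PowerSeries S) Ω (PowerSeries.C ζ)⟯ := by
  rw [tamePoly, map_prod]
  refine prod_mem fun s _ => ?_
  rw [map_pow]
  exact pow_mem (linFactor_mem_adjoin k S K Ω ζ a _) _

/-- The Kummer extensions generated by roots of the tame polynomials are independent of any given
finite Galois extension, with finitely many exceptions. -/
theorem exists_forall_pow_notMem [Infinite k] (hn : 1 < n) (hζ : IsPrimitiveRoot ζ n)
    (E : IntermediateField K Ω) [FiniteDimensional K E] [IsGalois K E] (y : k → PowerSeries S)
    (hy : ∀ a, y a ^ n = (tamePoly n ζ (algebraMap k S a) : S[X])) :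
    ∃ a, ∀ e, 0 < e → e < n → algebraMap _ Ω (y a) ^ e ∉
      E ⊔ K⟮algebraMap (PowerSeries S) Ω (PowerSeries.C ζ)⟯ := by
  set z := algebraMap (PowerSeries S) Ω (PowerSeries.C ζ) with hz
  have hzn := isPrimitiveRoot_algebraMap_C S Ω hζ
  have hzK := isIntegral_algebraMap_C S K Ω hζ
  have hG := KummerDescent.isGalois_adjoin_primitiveRoot (K := K) hzn hzK
  have : FiniteDimensional K K⟮z⟯ := adjoin.finiteDimensional hzK
  have hyn : ∀ a, algebraMap _ Ω (y a) ^ n = polynomialToSeries S Ω (tamePoly n ζ (algebraMap k S a)) := by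
    intro a
    rw [← map_pow, hy]
    rfl
  have hy0 : ∀ a, algebraMap _ Ω (y a) ≠ 0 := by
    intro a h
    have := hyn a
    rw [h, zero_pow (NeZero.ne n), eq_comm,
      map_eq_zero_iff _ (polynomialToSeries_injective S Ω)] at this
    exact tamePoly_ne_zero _ this
  by_contra! H
  have H' : ∀ a, ∃ e : Fin n, 0 < (e : ℕ) ∧ algebraMap _ Ω (y a) ^ (e : ℕ) ∈ E ⊔ K⟮z⟯ := by
    intro a
    obtain ⟨e, h1, h2, h3⟩ := H a
    exact ⟨⟨e, h2⟩, h1, h3⟩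
  choose ε hε hεE using H'
  obtain ⟨e, he⟩ := Finite.exists_infinite_fiber ε
  obtain ⟨A, hA, hAdiv⟩ := KummerDescent.exists_infinite_div_mem (K := K) hzn (E ⊔ K⟮z⟯)
    (le_sup_right (a := E) (mem_adjoin_simple_self K z))
    (fun a : ε ⁻¹' {e} => algebraMap _ Ω (y a) ^ (e : ℕ)) (fun a => pow_ne_zero _ (hy0 a))
    (fun a => by have := hεE a; rwa [show ε a = e from a.2] at this)
    (fun a => by
      rw [← pow_mul, mul_comm, pow_mul, hyn]
      exact pow_mem (tamePoly_mem_adjoin k S K Ω a) _)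
  have hinj : Function.Injective (fun a : ε ⁻¹' {e} => algebraMap k S a) :=
    (algebraMap k S).injective.comp Subtype.val_injective
  have hex : ∀ B : Set S, B.Finite → ∃ a ∈ A, algebraMap k S a ∉ B := by
    intro B hB
    obtain ⟨a, ha, ha'⟩ := (hA.sdiff (hB.preimage hinj.injOn)).nonempty
    exact ⟨a, ha, ha'⟩
  obtain ⟨a, haA, ha⟩ := hex {-ζ} (Set.finite_singleton _)
  have ha' : ζ + algebraMap k S a ≠ 0 := fun h => ha (eq_neg_of_add_eq_zero_right h)
  obtain ⟨b, hbA, hb⟩ := hex (Set.range fun s : (ZMod n)ˣ =>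
    ζ + algebraMap k S a - ζ ^ (s : ZMod n).val) (Set.finite_range _)
  obtain ⟨P, Q, hQ, hPQ⟩ := exists_mul_eq_of_mem_adjoin k S K Ω ζ (hAdiv a haA b hbA)
  refine pow_mul_tamePoly_pow_ne hn hζ ha' (b := algebraMap k S b) (e := e) (P := P) (Q := Q) ?_ ?_
    e.2 hQ ?_
  · intro s h
    exact hb ⟨s, by rw [← h]; ring⟩
  · have := hε a
    rwa [show ε a = e from a.2] at this
  · apply polynomialToSeries_injective S Ω
    rw [map_mul, map_mul, map_pow, map_pow, map_pow, map_pow, ← hPQ, ← hyn, ← hyn]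
    have h0 := hy0 b
    rw [pow_right_comm _ n, pow_right_comm _ n, mul_pow, div_pow, mul_right_comm,
      div_mul_cancel₀ _ (pow_ne_zero _ (pow_ne_zero _ h0)), mul_comm]

theorem isAmplyRealizable_of_natCast_ne_zero [Infinite k] [IsGalois k S] [IsSepClosed S]
    (n : ℕ) (hn : (n : k) ≠ 0) :
    IsAmplyRealizable (invariantSeries k S K Ω) (Multiplicative (ZMod n)) := by
  have hn0 : n ≠ 0 := by rintro rfl; simp at hn
  have hne : NeZero n := ⟨hn0⟩
  have hnS : (n : S) ≠ 0 := by
    rw [← map_natCast (algebraMap k S)]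
    rwa [_root_.map_ne_zero]
  have hneS : NeZero (n : S) := ⟨hnS⟩
  rcases eq_or_ne n 1 with rfl | hn1
  · have : Subsingleton (Multiplicative (ZMod 1)) := inferInstanceAs (Subsingleton (Fin 1))
    exact IsAmplyRealizable.of_subsingleton _
  have hn1 : 1 < n := by omega
  obtain ⟨ζ, hζ⟩ := HasEnoughRootsOfUnity.exists_primitiveRoot S n
  intro E hE hEG
  have hroot : ∀ a : k, ∃ y : PowerSeries S,
      y ^ n = (tamePoly n ζ (algebraMap k S a) : S[X]) ∧ PowerSeries.constantCoeff y = 1 := by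
    intro a
    refine exists_nth_root n hnS _ ?_
    have := constantCoeff_tamePoly (n := n) (ζ := ζ) (algebraMap k S a)
    simpa using this
  choose y hy hy1 using hroot
  obtain ⟨a, ha⟩ := exists_forall_pow_notMem k S K Ω hn1 hζ E y hy
  have hzn := isPrimitiveRoot_algebraMap_C S Ω hζ
  refine KummerDescent.exists_cyclic hzn (isIntegral_algebraMap_C S K Ω hζ) (y := algebraMap _ Ω (y a))
    ?_ ?_ (seriesAut k S K Ω).range ?_ ?_ (invariantSeries_inf_adjoin k S K Ω hζ) E ha
  · intro h
    rw [map_eq_zero_iff _ (IsFractionRing.injective (PowerSeries S) Ω)] at h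
    have := hy1 a
    simp [h] at this
  · rw [← map_pow, hy]
    exact tamePoly_mem_adjoin k S K Ω a
  · rintro _ ⟨γ, rfl⟩
    have hγζ : IsPrimitiveRoot (γ ζ) n := hζ.map_of_injective γ.injective
    obtain ⟨j, hj, hcop, hγ⟩ := hζ.isPrimitiveRoot_iff.1 hγζ
    set c := ZMod.unitOfCoprime j hcop
    have hc : (c : ZMod n).val = j := by
      rw [ZMod.coe_unitOfCoprime, ZMod.val_natCast, Nat.mod_eq_of_lt hj]
    have hγ' : (γ : S →+* S) ζ = ζ ^ (c : ZMod n).val := by rw [hc, hγ]; rfl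
    obtain ⟨q, hq⟩ := tamePoly_pow hζ (γ : S →+* S) c hγ' (γ.commutes a)
    rw [hc] at hq hγ'
    set h : S[X] := ∏ s : (ZMod n)ˣ, linFactor (ζ ^ (s : ZMod n).val + algebraMap k S a) ^ q s
    have hh : Polynomial.constantCoeff h = 1 := by
      simp only [h, map_prod, map_pow, constantCoeff_linFactor, one_pow, Finset.prod_const_one]
    have hhK : polynomialToSeries S Ω h ∈ K⟮algebraMap (PowerSeries S) Ω (PowerSeries.C ζ)⟯ := by
      simp only [h, map_prod, map_pow]
      exact prod_mem fun s _ => pow_mem (linFactor_mem_adjoin k S K Ω ζ a _) _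
    have hh0 : polynomialToSeries S Ω h ≠ 0 := by
      rw [map_ne_zero_iff _ (polynomialToSeries_injective S Ω)]
      rintro h0
      simp [h0] at hh
    have key : y a ^ j = PowerSeries.map (γ : S →+* S) (y a) * (h : PowerSeries S) := by
      refine nth_root_unique n hnS ?_ ?_ ?_
      · rw [← pow_mul, mul_comm, pow_mul, hy, mul_pow, ← map_pow, hy, ← Polynomial.coe_pow, hq,
          Polynomial.coe_mul, Polynomial.coe_pow]
        congr 1
        ext i
        simp
      · rw [map_pow, hy1, one_pow]
      · rw [map_mul]
        have h1 : PowerSeries.constantCoeff (PowerSeries.map (γ : S →+* S) (y a)) = 1 := by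
          have := hy1 a
          rw [← PowerSeries.coeff_zero_eq_constantCoeff_apply] at this ⊢
          rw [PowerSeries.coeff_map, this, map_one]
        rw [h1, one_mul]
        simpa using hh
    refine ⟨j, ?_, (polynomialToSeries S Ω h)⁻¹, inv_mem hhK, ?_⟩
    · rw [seriesAut_algebraMap, PowerSeries.map_C, hγ', map_pow, map_pow]
    · rw [seriesAut_algebraMap, ← map_pow, key, map_mul, polynomialToSeries_apply,
        mul_inv_cancel_right₀]
      exact hh0
  · rintro _ ⟨γ, rfl⟩ hγ
    rw [seriesAut_algebraMap, PowerSeries.map_C] at hγ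
    have hγ' : (γ : S →+* S) ζ = ζ :=
      PowerSeries.C_injective (IsFractionRing.injective (PowerSeries S) Ω hγ)
    rw [seriesAut_algebraMap]
    congr 1
    refine nth_root_unique n hnS ?_ ?_ (hy1 a)
    · rw [← map_pow, hy]
      have := map_tamePoly_of_fixes (n := n) (γ : S →+* S) hγ' (γ.commutes a)
      conv_rhs => rw [← this]
      ext i
      simp
    · have := hy1 a
      rw [← PowerSeries.coeff_zero_eq_constantCoeff_apply] at this ⊢
      rw [PowerSeries.coeff_map, this, map_one]

end SeriesExpansion

/-! ### Cyclic extensions of degree a power of the characteristic -/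

namespace ArtinSchreier

open IntermediateField

theorem exists_natCast_eq {L : Type*} [Field L] {p : ℕ} [Fact p.Prime] [CharP L p] {x : L}
    (hx : x ^ p = x) : ∃ m : ℕ, x = m := by
  rw [← Subfield.mem_bot_iff_pow_eq_self, ← ZMod.fieldRange_castHom_eq_bot p] at hx
  obtain ⟨m, rfl⟩ := hx
  refine ⟨m.val, ?_⟩
  rw [← map_natCast (ZMod.castHom (dvd_refl p) L), ZMod.natCast_zmod_val]

theorem exists_eq_add_natCast {L : Type*} [Field L] {p : ℕ} [Fact p.Prime] [CharP L p] {x y : L}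
    (h : x ^ p - x = y ^ p - y) : ∃ m : ℕ, x = y + m := by
  obtain ⟨m, hm⟩ := exists_natCast_eq (p := p) (x := x - y) (by
    rw [sub_pow_char]
    linear_combination h)
  exact ⟨m, by rw [← hm]; ring⟩

theorem isGalois_of_finrank_le_orderOf {K L : Type*} [Field K] [Field L] [Algebra K L]
    [FiniteDimensional K L] (τ : L ≃ₐ[K] L) (h : Module.finrank K L ≤ orderOf τ) :
    IsGalois K L ∧ Module.finrank K L = orderOf τ := by
  have h1 : Nat.card (L ≃ₐ[K] L) ≤ Module.finrank K L := by
    rw [Nat.card_eq_fintype_card]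
    exact AlgEquiv.card_le
  have h2 : orderOf τ ≤ Nat.card (L ≃ₐ[K] L) := orderOf_le_card
  exact ⟨IsGalois.of_card_aut_eq_finrank _ _ (by omega), by omega⟩

theorem exists_algEquiv_of_mem_fieldRange {K L C : Type*} [Field K] [Field L] [Field C]
    [Algebra K L] [Algebra K C] [FiniteDimensional K L] {s : Set L} (hs : adjoin K s = ⊤)
    (j g : L →ₐ[K] C) (h : ∀ x ∈ s, g x ∈ j.fieldRange) : ∃ τ : L ≃ₐ[K] L, ∀ x, j (τ x) = g x := by
  have h1 : ∀ x, g x ∈ j.fieldRange := by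
    have : adjoin K s ≤ j.fieldRange.comap g := adjoin_le_iff.2 h
    rw [hs] at this
    exact fun x => this trivial
  let e : L ≃ₐ[K] j.fieldRange := AlgEquiv.ofInjectiveField j
  let f : L →ₐ[K] L := e.symm.toAlgHom.comp (g.codRestrict j.fieldRange.toSubalgebra h1)
  refine ⟨AlgEquiv.ofBijective f f.bijective, fun x => ?_⟩
  exact congrArg Subtype.val (e.apply_symm_apply ⟨g x, h1 x⟩)

theorem exists_extension {E L C : Type*} [Field E] [Field L] [Field C] [Algebra E L]
    [Algebra.IsAlgebraic E L] [IsAlgClosed C] (f : E →+* C) :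
    ∃ g : L →+* C, ∀ x, g (algebraMap E L x) = f x := by
  let := f.toAlgebra
  let g : L →ₐ[E] C := IsAlgClosed.lift
  exact ⟨g, g.commutes⟩

section Polynomial

open Polynomial

variable {E L : Type*} [Field E] [Field L] [Algebra E L] {p : ℕ} [Fact p.Prime]
  {θ : L} {α : E}

theorem monic_X_pow_sub_X_sub_C (p : ℕ) [Fact p.Prime] (α : E) :
    (X ^ p - (X + C α) : E[X]).Monic := by
  refine monic_X_pow_sub ?_
  rw [degree_X_add_C]
  exact_mod_cast (Fact.out : p.Prime).one_lt

theorem natDegree_X_pow_sub_X_sub_C (p : ℕ) [Fact p.Prime] (α : E) :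
    (X ^ p - (X + C α) : E[X]).natDegree = p := by
  rw [natDegree_sub_eq_left_of_natDegree_lt, natDegree_X_pow]
  rw [natDegree_X_add_C, natDegree_X_pow]
  exact (Fact.out : p.Prime).one_lt

omit [Fact p.Prime] in
theorem aeval_X_pow_sub_X_sub_C (hθ : θ ^ p - θ = algebraMap E L α) :
    aeval θ (X ^ p - (X + C α) : E[X]) = 0 := by
  simp [← hθ]

theorem isIntegral_root (hθ : θ ^ p - θ = algebraMap E L α) : IsIntegral E θ :=
  ⟨_, monic_X_pow_sub_X_sub_C p α, aeval_X_pow_sub_X_sub_C hθ⟩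

omit [Fact p.Prime] in
theorem isSeparable_root [CharP E p] (hθ : θ ^ p - θ = algebraMap E L α) : IsSeparable E θ := by
  refine Separable.of_dvd ?_ (minpoly.dvd E θ (aeval_X_pow_sub_X_sub_C hθ))
  rw [separable_def]
  have : derivative (X ^ p - (X + C α) : E[X]) = -1 := by simp [derivative_X_pow]
  rw [this]
  exact isCoprime_one_right.neg_right

theorem finrank_le (hθ : θ ^ p - θ = algebraMap E L α) (htop : E⟮θ⟯ = ⊤) :
    Module.finrank E L ≤ p := by
  rw [← finrank_top', ← htop, adjoin.finrank (isIntegral_root hθ)]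
  refine (natDegree_le_of_dvd (minpoly.dvd E θ (aeval_X_pow_sub_X_sub_C hθ))
    (monic_X_pow_sub_X_sub_C p α).ne_zero).trans_eq (natDegree_X_pow_sub_X_sub_C p α)

end Polynomial

/-- An Artin-Schreier extension of degree `p`. -/
theorem exists_orderOf_eq {K L : Type*} [Field K] [Field L] [Algebra K L] {p : ℕ} [Fact p.Prime]
    [CharP K p] {θ : L} {α : K} (hθ : θ ^ p - θ = algebraMap K L α) (htop : K⟮θ⟯ = ⊤)
    (hθK : θ ∉ (algebraMap K L).range) : FiniteDimensional K L ∧ IsGalois K L ∧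
      Module.finrank K L = p ∧ ∃ τ : L ≃ₐ[K] L, orderOf τ = p := by
  have hp : p.Prime := Fact.out
  have hfin : FiniteDimensional K L := by
    have := adjoin.finiteDimensional (isIntegral_root hθ)
    rw [htop] at this
    exact topEquiv.toLinearEquiv.finiteDimensional
  have hsep : Algebra.IsSeparable K L := by
    have := (isSeparable_adjoin_simple_iff_isSeparable K L).2 (isSeparable_root hθ)
    rw [htop] at this
    exact (AlgEquiv.Algebra.isSeparable_iff topEquiv).1 this
  let C := AlgebraicClosure L
  let j : L →ₐ[K] C := IsScalarTower.toAlgHom K L C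
  have hC : CharP C p := charP_of_injective_algebraMap (algebraMap K C).injective p
  have hL : CharP L p := charP_of_injective_algebraMap (algebraMap K L).injective p
  have h1 : 1 < Fintype.card (L →ₐ[K] C) := by
    rw [AlgHom.card]
    by_contra! h
    have h2 : θ ∈ (⊥ : IntermediateField K L) := by
      rw [← finrank_adjoin_simple_eq_one_iff, htop, finrank_top']
      have := Module.finrank_pos (R := K) (M := L)
      omega
    exact hθK h2
  obtain ⟨g, hg⟩ := Fintype.exists_ne_of_one_lt_card h1 j
  obtain ⟨m, hm⟩ := exists_eq_add_natCast (p := p) (x := g θ) (y := j θ) (by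
    rw [← map_pow, ← map_pow, ← map_sub, ← map_sub, hθ, AlgHom.commutes, AlgHom.commutes])
  obtain ⟨τ, hτ⟩ := exists_algEquiv_of_mem_fieldRange htop j g (by
    intro x hx
    rw [Set.mem_singleton_iff.1 hx]
    exact ⟨θ + m, by rw [hm]; simp⟩)
  have hτθ : τ θ = θ + m := (show Function.Injective j from j.injective) (by rw [hτ, hm]; simp)
  have hpow : ∀ i : ℕ, (τ ^ i) θ = θ + i * m := by
    intro i
    induction i with
    | zero => simp
    | succ i ih =>
      rw [pow_succ, AlgEquiv.mul_apply, hτθ, map_add, ih, map_natCast]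
      push_cast
      ring
  have hτ1 : τ ≠ 1 := by
    rintro rfl
    refine hg (AlgHom.ext fun x => ?_)
    rw [← hτ]
    rfl
  have hord : orderOf τ = p := by
    refine orderOf_eq_prime ?_ hτ1
    refine KummerDescent.algEquiv_ext_of_adjoin_eq_top htop ?_
    rintro _ rfl
    simp [hpow]
  obtain ⟨h3, h4⟩ := isGalois_of_finrank_le_orderOf τ (by rw [hord]; exact finrank_le hθ htop)
  exact ⟨hfin, h3, h4.trans hord, τ, hord⟩

/-- The additive form of Hilbert 90 for a cyclic group. -/
theorem exists_sub_eq {E : Type*} [Field E] (σ : E ≃+* E) {q : ℕ}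
    {β γ : E} (hβ : ∑ i ∈ Finset.range q, (σ ^ i) β = 1)
    (hγ : ∑ i ∈ Finset.range q, (σ ^ i) γ = 0) : ∃ α, σ α = α + γ := by
  let s : ℕ → E := fun i => ∑ l ∈ Finset.range i, (σ ^ l) γ
  have hs : ∀ i, σ (s i) = s (i + 1) - γ := by
    intro i
    simp only [s, Finset.sum_range_succ' _ i, map_sum, pow_zero, pow_succ', RingAut.mul_apply,
      RingAut.one_apply]
    ring
  refine ⟨-∑ i ∈ Finset.range q, s i * (σ ^ i) β, ?_⟩
  have h1 : ∑ i ∈ Finset.range q, (σ ^ (i + 1)) β = 1 := by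
    simp only [pow_succ', RingAut.mul_apply]
    rw [← map_sum, hβ, map_one]
  have h2 : ∑ i ∈ Finset.range q, s (i + 1) * (σ ^ (i + 1)) β =
      ∑ i ∈ Finset.range q, s i * (σ ^ i) β := by
    have h3 := Finset.sum_range_succ (fun i => s i * (σ ^ i) β) q
    have h4 := Finset.sum_range_succ' (fun i => s i * (σ ^ i) β) q
    have h5 : s q = 0 := hγ
    have h6 : s 0 = 0 := Finset.sum_range_zero _
    simp only [h5, h6, zero_mul, add_zero] at h3 h4
    rw [← h4, h3]
  have h7 : ∀ i, σ (s i * (σ ^ i) β) = s (i + 1) * (σ ^ (i + 1)) β - γ * (σ ^ (i + 1)) β := by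
    intro i
    rw [map_mul, hs, pow_succ', RingAut.mul_apply]
    ring
  rw [map_neg, map_sum, Finset.sum_congr rfl fun i _ => h7 i, Finset.sum_sub_distrib, h2,
    ← Finset.mul_sum, h1]
  ring

/-- A cyclic extension of degree `p ^ r` extends to one of degree `p ^ (r + 1)`. -/
theorem exists_orderOf_eq_pow_succ {K E L : Type*} [Field K] [Field E] [Field L] [Algebra K E]
    [Algebra E L] [Algebra K L] [IsScalarTower K E L] [FiniteDimensional K E] {p r : ℕ}
    [Fact p.Prime] [CharP K p] (hr : r ≠ 0) (hE : Module.finrank K E = p ^ r) (σ : E ≃ₐ[K] E)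
    (hσ : σ ^ p ^ r = 1) {α β : E} (hβ : ∑ i ∈ Finset.range (p ^ r), (σ ^ i) β = 1)
    (hα : σ α = α + (β ^ p - β)) {θ : L} (hθ : θ ^ p - θ = algebraMap E L α) (htop : E⟮θ⟯ = ⊤) :
    FiniteDimensional K L ∧ IsGalois K L ∧ Module.finrank K L = p ^ (r + 1) ∧
      ∃ τ : L ≃ₐ[K] L, orderOf τ = p ^ (r + 1) := by
  have hp : p.Prime := Fact.out
  have hfinE : FiniteDimensional E L := by
    have := adjoin.finiteDimensional (isIntegral_root hθ)
    rw [htop] at this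
    exact topEquiv.toLinearEquiv.finiteDimensional
  have hfin : FiniteDimensional K L := FiniteDimensional.trans K E L
  let C := AlgebraicClosure L
  let j : L →ₐ[K] C := IsScalarTower.toAlgHom K L C
  have hC : CharP C p := charP_of_injective_algebraMap (algebraMap K C).injective p
  have hL : CharP L p := charP_of_injective_algebraMap (algebraMap K L).injective p
  obtain ⟨g₀, hg₀⟩ := exists_extension (L := L) (C := C)
    (((j : L →+* C).comp (algebraMap E L)).comp (σ : E →+* E))
  let g : L →ₐ[K] C :=
    { g₀ with
      commutes' := fun x => by
        change g₀ (algebraMap K L x) = _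
        rw [IsScalarTower.algebraMap_apply K E L, hg₀]
        change j (algebraMap E L (σ (algebraMap K E x))) = _
        rw [σ.commutes, ← IsScalarTower.algebraMap_apply, j.commutes] }
  have hg : ∀ x, g (algebraMap E L x) = j (algebraMap E L (σ x)) := hg₀
  obtain ⟨m, hm⟩ := exists_eq_add_natCast (p := p) (x := g θ) (y := j (θ + algebraMap E L β)) (by
    rw [← map_pow, ← map_pow, ← map_sub, ← map_sub, hθ, hg, hα, add_pow_char, map_add, map_sub,
      map_pow, ← hθ]
    congr 1
    ring)
  have hadj : adjoin K (insert θ (Set.range (algebraMap E L))) = ⊤ := by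
    rw [eq_top_iff]
    intro x _
    refine adjoin_le_subfield E {θ} (K := (adjoin K _).toSubfield) ?_ ?_ (htop ▸ mem_top : x ∈ E⟮θ⟯)
    · exact (Set.subset_insert _ _).trans (subset_adjoin K _)
    · exact (Set.singleton_subset_iff.2 (Set.mem_insert _ _)).trans (subset_adjoin K _)
  obtain ⟨τ, hτ⟩ := exists_algEquiv_of_mem_fieldRange hadj j g (by
    rintro _ (hx | ⟨x, rfl⟩)
    · rw [hx]
      exact ⟨θ + algebraMap E L β + m, by rw [hm]; simp⟩
    · exact ⟨_, (hg x).symm⟩)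
  have hτθ : τ θ = θ + algebraMap E L β + m := (show Function.Injective j from j.injective) (by rw [hτ, hm]; simp)
  have hτE : ∀ x, τ (algebraMap E L x) = algebraMap E L (σ x) := fun x =>
    (show Function.Injective j from j.injective) (by rw [hτ, hg])
  have hpowE : ∀ (i : ℕ) x, (τ ^ i) (algebraMap E L x) = algebraMap E L ((σ ^ i) x) := by
    intro i
    induction i with
    | zero => simp
    | succ i ih =>
      intro x
      rw [pow_succ, AlgEquiv.mul_apply, hτE, ih, pow_succ, AlgEquiv.mul_apply]
  have hpow : ∀ i : ℕ, (τ ^ i) θ =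
      θ + algebraMap E L (∑ l ∈ Finset.range i, (σ ^ l) β) + i * m := by
    intro i
    induction i with
    | zero => simp
    | succ i ih =>
      rw [pow_succ, AlgEquiv.mul_apply, hτθ, map_add, map_add, ih, map_natCast, hpowE,
        Finset.sum_range_succ, map_add]
      push_cast
      ring
  have hq : (τ ^ p ^ r) θ = θ + 1 := by
    rw [hpow, hβ]
    simp [hr]
  have hq' : ∀ i : ℕ, ((τ ^ p ^ r) ^ i) θ = θ + i := by
    intro i
    induction i with
    | zero => simp
    | succ i ih =>
      rw [pow_succ, AlgEquiv.mul_apply, hq, map_add, map_one, ih]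
      push_cast
      ring
  have hord : orderOf τ = p ^ (r + 1) := by
    refine orderOf_eq_prime_pow ?_ ?_
    · intro h
      rw [h] at hq
      simp at hq
    · rw [pow_succ, pow_mul]
      refine KummerDescent.algEquiv_ext_of_adjoin_eq_top hadj ?_
      rintro _ (rfl | ⟨x, rfl⟩)
      · simp [hq']
      · rw [← pow_mul, hpowE, pow_mul, hσ, one_pow]
        simp
  obtain ⟨h3, h4⟩ := isGalois_of_finrank_le_orderOf τ (by
    rw [hord, ← Module.finrank_mul_finrank K E L, hE, pow_succ]
    exact Nat.mul_le_mul_left _ (finrank_le hθ htop))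
  exact ⟨hfin, h3, h4.trans hord, τ, hord⟩

/-- In a cyclic extension of `p`-power degree, an intermediate field is trivial as soon as it does
not contain some Artin-Schreier generator. -/
theorem eq_bot_of_notMem {K L : Type*} [Field K] [Field L] [Algebra K L] [FiniteDimensional K L]
    [IsGalois K L] {p r : ℕ} [Fact p.Prime] [CharP K p] (hL : Module.finrank K L = p ^ r)
    {τ : L ≃ₐ[K] L} (hτ : orderOf τ = p ^ r) {θ : L} {α : K} (hθ : θ ^ p - θ = algebraMap K L α)
    {N : IntermediateField K L} (hN : θ ∉ N) : N = ⊥ := by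
  have hp : p.Prime := Fact.out
  have hLp : CharP L p := charP_of_injective_algebraMap (algebraMap K L).injective p
  have hfix : ∀ σ : L ≃ₐ[K] L, (σ ^ p) θ = θ := by
    intro σ
    obtain ⟨m, hm⟩ := exists_eq_add_natCast (p := p) (x := σ θ) (y := θ) (by
      rw [← map_pow, ← map_sub, hθ, σ.commutes])
    have hpow : ∀ i : ℕ, (σ ^ i) θ = θ + i * m := by
      intro i
      induction i with
      | zero => simp
      | succ i ih =>
        rw [pow_succ, AlgEquiv.mul_apply, hm, map_add, ih, map_natCast]
        push_cast
        ring
    simp [hpow]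
  have hcard : Nat.card (L ≃ₐ[K] L) = p ^ r := by rw [IsGalois.card_aut_eq_finrank, hL]
  have hgen : ∀ σ, σ ∈ Subgroup.zpowers τ := by
    intro σ
    rw [Subgroup.eq_top_of_card_eq (Subgroup.zpowers τ)
      (by rw [Nat.card_zpowers, hτ, hcard])]
    trivial
  have hN' : ∃ σ ∈ N.fixingSubgroup, σ θ ≠ θ := by
    by_contra! H
    refine hN ?_
    rw [← IsGalois.fixedField_fixingSubgroup N]
    exact fun σ => H σ.1 σ.2
  obtain ⟨σ, hσ, hσθ⟩ := hN'
  obtain ⟨m, rfl⟩ := mem_powers_iff_mem_zpowers.2 (hgen σ)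
  have hm : ¬ p ∣ m := by
    rintro ⟨l, rfl⟩
    refine hσθ ?_
    have := hfix (τ ^ l)
    rwa [← pow_mul, mul_comm] at this
  have hcop : m.Coprime (orderOf τ) := by
    rw [hτ]
    exact (((Nat.Prime.coprime_iff_not_dvd hp).2 hm).symm).pow_right r
  obtain ⟨l, hl⟩ := exists_pow_eq_self_of_coprime hcop
  have htop : N.fixingSubgroup = ⊤ := by
    rw [eq_top_iff]
    intro ρ _
    refine Subgroup.zpowers_le.2 ?_ (hgen ρ)
    rw [← hl]
    exact pow_mem hσ l
  rw [← IsGalois.fixedField_fixingSubgroup N, htop, IsGalois.fixedField_top]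

end ArtinSchreier

namespace SeriesExpansion

open Polynomial IntermediateField

theorem pow_sub_self_ne {k : Type*} [Field k] {p : ℕ} (hp : 1 < p) {i j : ℕ} (hij : i < j)
    (hj : ¬ p ∣ j) (P : k[X]) : P ^ p - P ≠ X ^ j - X ^ i := by
  intro h
  have h1 : (X ^ j - X ^ i : k[X]).natDegree = j := by
    rw [natDegree_sub_eq_left_of_natDegree_lt (by simpa using hij), natDegree_X_pow]
  rw [← h] at h1
  rcases Nat.eq_zero_or_pos P.natDegree with h0 | h0
  · have h2 : (P ^ p - P).natDegree ≤ 0 :=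
      (natDegree_sub_le _ _).trans (by simp [h0])
    omega
  · rw [natDegree_sub_eq_left_of_natDegree_lt, natDegree_pow] at h1
    · exact hj ⟨_, h1.symm⟩
    · rw [natDegree_pow]
      nlinarith

variable (k S K Ω : Type*) [Field k] [Field S] [Field K] [Field Ω] [Algebra k S]
  [Algebra k[X] K] [Algebra (PowerSeries S) Ω] [Algebra K Ω]
  [IsFractionRing (PowerSeries S) Ω] [IsFractionRing k[X] K]
  [IsSeriesExpansion k S K Ω] (p : ℕ) [Fact p.Prime] [CharP k p]

omit [Algebra (PowerSeries S) Ω] [IsFractionRing (PowerSeries S) Ω]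
  [IsSeriesExpansion k S K Ω] in
theorem exists_notMem_of_pow_sub_self (E : IntermediateField K Ω)
    [FiniteDimensional K E] [IsGalois K E] (θ : ℕ → Ω)
    (hθ : ∀ i, θ i ^ p - θ i = algebraMap K Ω (algebraMap k[X] K (X ^ (p * i + 1)))) :
    ∃ i, θ i ∉ E := by
  have hp : p.Prime := Fact.out
  have hKp : CharP K p := by
    have := charP_of_injective_algebraMap (algebraMap k k[X]).injective p
    exact charP_of_injective_algebraMap (IsFractionRing.injective k[X] K) p
  have hEp : CharP E p := charP_of_injective_algebraMap (algebraMap K E).injective p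
  by_contra! H
  let w : ℕ → E := fun i => ⟨θ i, H i⟩
  have hw : ∀ i, w i ^ p - w i = algebraMap K E (algebraMap k[X] K (X ^ (p * i + 1))) :=
    fun i => Subtype.ext (hθ i)
  have h1 : ∀ i (σ : E ≃ₐ[K] E), ∃ m : Fin p, σ (w i) = w i + (m : ℕ) := by
    intro i σ
    obtain ⟨m, hm⟩ := ArtinSchreier.exists_eq_add_natCast (p := p) (x := σ (w i)) (y := w i) (by
      rw [← map_pow, ← map_sub, hw, σ.commutes])
    refine ⟨⟨m % p, Nat.mod_lt _ hp.pos⟩, ?_⟩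
    rw [hm]
    congr 1
    exact (CharP.cast_eq_mod E p m)
  choose m hm using h1
  obtain ⟨i, j, hij, hmij⟩ := Finite.exists_ne_map_eq_of_infinite m
  wlog hlt : i < j generalizing i j
  · exact this j i hij.symm hmij.symm (by omega)
  have h2 : w j - w i ∈ (⊥ : IntermediateField K E) := by
    rw [IsGalois.mem_bot_iff_fixed]
    intro σ
    rw [map_sub, hm, hm, hmij]
    ring
  obtain ⟨h, hh⟩ := h2
  have h3 : h ^ p - h = algebraMap k[X] K (X ^ (p * j + 1) - X ^ (p * i + 1)) := by
    apply (algebraMap K E).injective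
    rw [map_sub, map_pow, map_sub, map_sub, ← hw, ← hw]
    change algebraMap K E h = w j - w i at hh
    rw [hh, sub_pow_char]
    ring
  have h4 : IsIntegral k[X] h := by
    refine ⟨X ^ p - (X + C (X ^ (p * j + 1) - X ^ (p * i + 1))), monic_X_pow_sub ?_, ?_⟩
    · rw [degree_X_add_C]
      exact_mod_cast hp.one_lt
    · rw [eval₂_sub, eval₂_add, eval₂_X_pow, eval₂_X, eval₂_C, ← h3]
      ring
  obtain ⟨P, rfl⟩ := IsIntegrallyClosed.isIntegral_iff.1 h4
  refine pow_sub_self_ne hp.one_lt (i := p * i + 1) (j := p * j + 1) ?_ ?_ P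
    (IsFractionRing.injective k[X] K ?_)
  · have := Nat.mul_lt_mul_of_pos_left hlt hp.pos
    omega
  · rw [Nat.dvd_add_right (dvd_mul_right _ _)]
    exact hp.one_lt.ne' ∘ Nat.dvd_one.1
  · rw [← h3, map_sub, map_pow]

include p in
theorem exists_root_mem_invariantSeries {f : PowerSeries S} (hf : PowerSeries.constantCoeff f = 0)
    (hfD : algebraMap _ Ω f ∈ invariantSeries k S K Ω) :
    ∃ θ ∈ invariantSeries k S K Ω, θ ^ p - θ = algebraMap _ Ω f := by
  have hS : CharP S p := charP_of_injective_algebraMap (algebraMap k S).injective p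
  obtain ⟨y, hy, hy0⟩ := exists_artinSchreier_root p f hf
  refine ⟨algebraMap _ Ω y, ?_, by rw [← map_pow, ← map_sub, hy]⟩
  rw [mem_invariantSeries_iff] at hfD ⊢
  intro γ
  have h1 := hfD γ
  rw [seriesAut_algebraMap] at h1 ⊢
  have h2 := IsFractionRing.injective (PowerSeries S) Ω h1
  congr 1
  refine artinSchreier_root_unique p ?_ ?_ hy0
  · rw [← map_pow, ← map_sub, hy, h2]
  · rw [← PowerSeries.coeff_zero_eq_constantCoeff_apply] at hy0 ⊢
    rw [PowerSeries.coeff_map, hy0, map_zero]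

theorem exists_cyclic_prime_pow [IsGalois k S] {θ : Ω} (hθD : θ ∈ invariantSeries k S K Ω)
    {a : K} (hθ : θ ^ p - θ = algebraMap K Ω a) (hθK : θ ∉ (⊥ : IntermediateField K Ω)) (r : ℕ) :
    ∃ L ≤ invariantSeries k S K Ω, FiniteDimensional K L ∧ IsGalois K L ∧
      Module.finrank K L = p ^ (r + 1) ∧ (∃ τ : L ≃ₐ[K] L, orderOf τ = p ^ (r + 1)) ∧ θ ∈ L := by
  have hp : p.Prime := Fact.out
  have hKp : CharP K p := by
    have := charP_of_injective_algebraMap (algebraMap k k[X]).injective p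
    exact charP_of_injective_algebraMap (IsFractionRing.injective k[X] K) p
  induction r with
  | zero =>
    have htop : K⟮AdjoinSimple.gen K θ⟯ = ⊤ := by
      apply lift_injective K⟮θ⟯
      rw [lift_adjoin_simple, lift_top]
      rfl
    obtain ⟨h1, h2, h3, h4⟩ := ArtinSchreier.exists_orderOf_eq (K := K) (L := K⟮θ⟯) (p := p)
      (θ := AdjoinSimple.gen K θ) (α := a) (Subtype.ext hθ) htop (by
        rintro ⟨c, hc⟩
        exact hθK ⟨c, congrArg Subtype.val hc⟩)
    simp only [zero_add, pow_one]
    exact ⟨K⟮θ⟯, adjoin_simple_le_iff.2 hθD, h1, h2, h3, h4, mem_adjoin_simple_self K θ⟩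
  | succ r ih =>
    obtain ⟨L, hLD, hfin, hG, hrank, ⟨σ, hσ⟩, hθL⟩ := ih
    have hLp : CharP L p := charP_of_injective_algebraMap (algebraMap K L).injective p
    obtain ⟨β, hβ⟩ := Algebra.trace_surjective K L 1
    have hgen : ∀ τ, τ ∈ Subgroup.zpowers σ := by
      intro τ
      rw [Subgroup.eq_top_of_card_eq (Subgroup.zpowers σ)
        (by rw [Nat.card_zpowers, hσ, IsGalois.card_aut_eq_finrank, hrank])]
      trivial
    have hsum : ∑ i ∈ Finset.range (p ^ (r + 1)), (σ ^ i) β = 1 := by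
      classical
      rw [← map_one (algebraMap K L), ← hβ, trace_eq_sum_automorphisms,
        ← IsCyclic.image_range_orderOf hgen, hσ, Finset.sum_image]
      intro i hi j hj h
      refine pow_injOn_Iio_orderOf ?_ ?_ h
      · rw [hσ]; simpa using hi
      · rw [hσ]; simpa using hj
    have hcoe : ∀ (i : ℕ) (x : L), ((σ : L ≃+* L) ^ i : RingAut L) x = (σ ^ i) x := by
      intro i x
      induction i with
      | zero => rfl
      | succ i ih =>
        rw [pow_succ', pow_succ', RingAut.mul_apply, ih]
        rfl
    have hsum' : ∑ i ∈ Finset.range (p ^ (r + 1)), (σ ^ i) (β ^ p - β) = 0 := by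
      simp only [map_sub, map_pow, Finset.sum_sub_distrib]
      rw [← sum_pow_char p, hsum, one_pow, sub_self]
    obtain ⟨α, hα⟩ := ArtinSchreier.exists_sub_eq (σ : L ≃+* L) (q := p ^ (r + 1)) (β := β)
      (γ := β ^ p - β) (by simpa only [hcoe] using hsum) (by simpa only [hcoe] using hsum')
    obtain ⟨c, f, hf, hcf⟩ := exists_sub_eq_algebraMap k S K Ω α (hLD α.2)
    obtain ⟨η, hηD, hη⟩ := exists_root_mem_invariantSeries k S K Ω p hf (by
      rw [← hcf]
      exact sub_mem (hLD α.2) (_root_.algebraMap_mem _ c))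
    rw [← hcf] at hη
    have htop : L⟮AdjoinSimple.gen L η⟯ = ⊤ := by
      apply lift_injective L⟮η⟯
      rw [lift_adjoin_simple, lift_top]
      rfl
    obtain ⟨h1, h2, h3, h4⟩ := ArtinSchreier.exists_orderOf_eq_pow_succ (K := K) (E := L)
      (L := L⟮η⟯) (p := p) (r := r + 1) (Nat.succ_ne_zero r) hrank σ
      (by rw [← hσ, pow_orderOf_eq_one]) (α := α - algebraMap K L c) hsum (by
        change σ α = α + _ at hα
        rw [map_sub, hα, σ.commutes]
        ring) (θ := AdjoinSimple.gen L η) (Subtype.ext hη) htop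
    refine ⟨L⟮η⟯.restrictScalars K, ?_, h1, h2, h3, h4, ?_⟩
    · refine adjoin_le_subfield L {η} (K := (invariantSeries k S K Ω).toSubfield) ?_ ?_
      · rintro _ ⟨x, rfl⟩
        exact hLD x.2
      · rintro _ rfl
        exact hηD
    · exact _root_.algebraMap_mem L⟮η⟯ (⟨θ, hθL⟩ : L)

theorem isAmplyRealizable_prime_pow [IsGalois k S] (r : ℕ) :
    IsAmplyRealizable (invariantSeries k S K Ω) (Multiplicative (ZMod (p ^ r))) := by
  have hp : p.Prime := Fact.out
  have hKp : CharP K p := by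
    have := charP_of_injective_algebraMap (algebraMap k k[X]).injective p
    exact charP_of_injective_algebraMap (IsFractionRing.injective k[X] K) p
  rcases r with - | r
  · rw [pow_zero]
    have : Subsingleton (Multiplicative (ZMod 1)) := inferInstanceAs (Subsingleton (Fin 1))
    exact IsAmplyRealizable.of_subsingleton _
  intro E hE hEG
  have hroot : ∀ i : ℕ, ∃ θ ∈ invariantSeries k S K Ω,
      θ ^ p - θ = algebraMap K Ω (algebraMap k[X] K (X ^ (p * i + 1))) := by
    intro i
    have h1 : algebraMap K Ω (algebraMap k[X] K (X ^ (p * i + 1))) =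
        algebraMap (PowerSeries S) Ω (PowerSeries.X ^ (p * i + 1)) := by
      rw [map_pow, map_pow, map_pow, algebraMap_X k S K Ω]
    rw [h1]
    refine exists_root_mem_invariantSeries k S K Ω p (by simp) ?_
    rw [map_pow]
    exact pow_mem (algebraMap_X_mem_invariantSeries k S K Ω) _
  choose θ hθD hθ using hroot
  obtain ⟨i, hi⟩ := exists_notMem_of_pow_sub_self k K Ω p E θ hθ
  obtain ⟨L, hLD, hfin, hG, hrank, ⟨τ, hτ⟩, hθL⟩ := exists_cyclic_prime_pow k S K Ω p (hθD i)
    (hθ i) (fun h => hi (bot_le (a := E) h)) r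
  have hcard : Nat.card (L ≃ₐ[K] L) = p ^ (r + 1) := by
    rw [IsGalois.card_aut_eq_finrank, hrank]
  have hcyc : IsCyclic (L ≃ₐ[K] L) := isCyclic_of_orderOf_eq_card τ (by rw [hτ, hcard])
  refine ⟨L, hLD, hfin, hG, ⟨mulEquivOfCyclicCardEq ?_⟩, ?_⟩
  · rw [hcard]
    exact (Nat.card_zmod _).symm
  · have h1 : E.comap L.val = ⊥ := ArtinSchreier.eq_bot_of_notMem (p := p) hrank hτ
      (θ := ⟨θ i, hθL⟩) (Subtype.ext (hθ i)) hi
    rw [eq_bot_iff]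
    rintro x ⟨hxL, hxE⟩
    have h2 : (⟨x, hxL⟩ : L) ∈ E.comap L.val := hxE
    rw [h1] at h2
    obtain ⟨c, hc⟩ := h2
    exact ⟨c, congrArg Subtype.val hc⟩

end SeriesExpansion

namespace SeriesExpansion

open Polynomial

theorem isAmplyRealizable (k S K Ω : Type*) [Field k] [Field S] [Field K] [Field Ω] [Algebra k S]
    [Algebra k[X] K] [Algebra (PowerSeries S) Ω] [Algebra K Ω]
    [IsFractionRing (PowerSeries S) Ω] [IsFractionRing k[X] K]
    [IsSeriesExpansion k S K Ω] [Infinite k] [IsGalois k S] [IsSepClosed S]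
    (G : Type*) [CommGroup G] [Finite G] : IsAmplyRealizable (invariantSeries k S K Ω) G := by
  refine IsAmplyRealizable.of_finite_commGroup (fun p r hp => ?_) G
  by_cases hpk : (p : k) = 0
  · have : Fact p.Prime := ⟨hp⟩
    have : CharP k p := (CharP.charP_iff_prime_eq_zero hp).2 hpk
    exact isAmplyRealizable_prime_pow k S K Ω p r
  · exact isAmplyRealizable_of_natCast_ne_zero k S K Ω (p ^ r) (by
      rw [Nat.cast_pow]
      exact pow_ne_zero r hpk)

/-- Every finite abelian group is a Galois group over the field of rational functions over an
infinite field `k`, for an extension admitting a place with values in `k`. -/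
theorem exists_isGalois_with_place (k K : Type u) [Field k] [Infinite k] [Field K] [Algebra k[X] K]
    [IsFractionRing k[X] K] (G : Type*) [CommGroup G] [Finite G] :
    ∃ (L : Type u) (_ : Field L) (_ : Algebra K L), FiniteDimensional K L ∧ IsGalois K L ∧
      Nonempty ((L ≃ₐ[K] L) ≃* G) ∧ ∃ (O : ValuationSubring L) (π : O →+* k), ∀ a : k,
        ∃ h : algebraMap K L (algebraMap k[X] K (C a)) ∈ O, π ⟨_, h⟩ = a := by
  let S := SeparableClosure k
  let Ω := FractionRing (PowerSeries S)
  let f : k[X] →+* Ω := (algebraMap (PowerSeries S) Ω).comp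
    ((Polynomial.coeToPowerSeries.ringHom (R := S)).comp (mapRingHom (algebraMap k S)))
  have hf : Function.Injective f := by
    refine (IsFractionRing.injective (PowerSeries S) Ω).comp (Function.Injective.comp ?_
      (map_injective _ (algebraMap k S).injective))
    exact Polynomial.coe_injective S
  let _ : Algebra K Ω := (IsFractionRing.lift (K := K) hf).toAlgebra
  have : IsSeriesExpansion k S K Ω := ⟨fun P => IsFractionRing.lift_algebraMap hf P⟩
  obtain ⟨L, hL, h1, h2, h3, -⟩ := isAmplyRealizable k S K Ω G ⊥ inferInstance inferInstance
  obtain ⟨O, π, h⟩ := exists_place k S K Ω L hL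
  exact ⟨L, inferInstance, inferInstance, h1, h2, h3, O, π, h⟩

end SeriesExpansion

/-! ### Division rings of finite dimension over their center -/

open scoped TensorProduct in
/-- Every endomorphism of a division ring of finite dimension over its center is a sum of maps
`x ↦ a * x * b`. -/
theorem DivisionRing.exists_eq_sum_mul_mul {H : Type*} [DivisionRing H]
    [FiniteDimensional (Subring.center H) H] (f : H →ₗ[Subring.center H] H) :
    ∃ (n : ℕ) (a b : Fin n → H), ∀ x, f x = ∑ j, a j * x * b j := by
  let k := Subring.center H
  let R := (AlgHom.mulLeftRight k H).range
  have hmul : ∀ (a b : H), ∃ r : R, ∀ x : H, r • x = a * x * b := fun a b =>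
    ⟨⟨_, a ⊗ₜ[k] MulOpposite.op b, rfl⟩, fun x => AlgHom.mulLeftRight_apply k H a _ x⟩
  have hsimple : IsSimpleModule R H := by
    rw [isSimpleModule_iff]
    refine { exists_pair_ne := ⟨⊥, ⊤, bot_ne_top⟩, eq_bot_or_eq_top := fun N => ?_ }
    rw [or_iff_not_imp_left]
    intro hN
    obtain ⟨x, hx, hx0⟩ := N.exists_mem_ne_zero_of_ne_bot hN
    rw [eq_top_iff]
    intro y _
    obtain ⟨r, hr⟩ := hmul (y * x⁻¹) 1
    have h := N.smul_mem r hx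
    rwa [hr, mul_one, inv_mul_cancel_right₀ hx0] at h
  have hcentral : ∀ g : Module.End R H, ∃ c : k, ∀ x, g x = c • x := by
    intro g
    have h1 : ∀ x, g x = x * g 1 := by
      intro x
      obtain ⟨r, hr⟩ := hmul x 1
      have h := g.map_smul r 1
      simpa [hr] using h
    have h2 : ∀ x, g x = g 1 * x := by
      intro x
      obtain ⟨r, hr⟩ := hmul 1 x
      have h := g.map_smul r 1
      simpa [hr] using h
    exact ⟨⟨g 1, Subring.mem_center_iff.2 fun x => by rw [← h1, h2]⟩, fun x => h2 x⟩
  let f' : Module.End (Module.End R H) H :=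
    { toFun := f
      map_add' := f.map_add
      map_smul' := fun g x => by
        obtain ⟨c, hc⟩ := hcentral g
        change f (g x) = g (f x)
        rw [hc, hc, f.map_smul] }
  obtain ⟨s, hs⟩ := Module.Finite.fg_top (R := k) (M := H)
  obtain ⟨⟨_, t, rfl⟩, hr⟩ := jacobson_density (R := R) (M := H) f' s
  have hf : f = AlgHom.mulLeftRight k H t := LinearMap.ext_on hs fun m hm => hr m hm
  obtain ⟨n, a, b, rfl⟩ := TensorProduct.exists_sum_tmul_eq t
  refine ⟨n, a, fun j => (b j).unop, fun x => ?_⟩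
  rw [hf, map_sum, LinearMap.sum_apply]
  exact Finset.sum_congr rfl fun j _ => AlgHom.mulLeftRight_apply k H _ _ x

/-! ### Scalar extension of a central division algebra -/

open scoped TensorProduct

theorem sum_smul_mul_sum_smul {E A ι : Type*} [CommRing E] [Ring A] [Algebra E A] [Fintype ι]
    {b : ι → A} {c : ι → ι → ι → E} (hc : ∀ i j, b i * b j = ∑ s, c i j s • b s) (u v : ι → E) :
    (∑ i, u i • b i) * ∑ j, v j • b j = ∑ s, (∑ i, ∑ j, u i * v j * c i j s) • b s := by
  simp only [Finset.sum_mul_sum, smul_mul_smul_comm, hc, Finset.smul_sum, smul_smul,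
    Finset.sum_smul]
  rw [Finset.sum_comm (s := Finset.univ) (t := Finset.univ)
    (f := fun s i => ∑ j, (u i * v j * c i j s) • b s)]
  exact Finset.sum_congr rfl fun i _ => Finset.sum_comm

theorem ValuationSubring.exists_div_mem {L ι : Type*} [Field L] [Finite ι] (O : ValuationSubring L)
    {v : ι → L} (hv : v ≠ 0) : ∃ i, v i ≠ 0 ∧ ∀ j, v j / v i ∈ O := by
  obtain ⟨j, hj⟩ := Function.ne_iff.1 hv
  have : Nonempty ι := ⟨j⟩
  obtain ⟨i, hi⟩ := Finite.exists_max fun i => O.valuation (v i)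
  have hi0 : v i ≠ 0 := by
    intro h
    have := hi j
    rw [h, map_zero, le_zero_iff, map_eq_zero] at this
    exact hj this
  refine ⟨i, hi0, fun j => ?_⟩
  rw [← O.valuation_le_one_iff, map_div₀]
  exact div_le_one_of_le₀ (hi j) zero_le

/-- If `F` has structure constants in `k`, then a `k`-valued place of `L` shows that the scalar
extension of `F` to `L` is still a domain. -/
theorem noZeroDivisors_tensorProduct_of_place {k K L F ι : Type*} [Field k] [Field K] [Field L]
    [DivisionRing F] [Algebra k K] [Algebra K L] [Algebra K F] [Fintype ι]
    (b : Module.Basis ι K F) (c : ι → ι → ι → k)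
    (hc : ∀ i j, b i * b j = ∑ s, algebraMap k K (c i j s) • b s)
    (O : ValuationSubring L) (π : O →+* k)
    (hπ : ∀ a : k, ∃ h : algebraMap K L (algebraMap k K a) ∈ O, π ⟨_, h⟩ = a) :
    NoZeroDivisors (L ⊗[K] F) := by
  let B := Algebra.TensorProduct.basis L b
  have hB : ∀ i j, B i * B j = ∑ s, algebraMap K L (algebraMap k K (c i j s)) • B s := by
    intro i j
    simp only [B, Algebra.TensorProduct.basis_apply, Algebra.TensorProduct.tmul_mul_tmul, hc,
      one_mul, TensorProduct.tmul_sum, TensorProduct.tmul_smul, algebraMap_smul]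
  choose hO hπ using hπ
  have hscale : ∀ x : L ⊗[K] F, x ≠ 0 → ∃ (a : L) (v : ι → O), a ≠ 0 ∧ (∃ i, v i = 1) ∧
      a • x = ∑ i, (v i : L) • B i := by
    intro x hx
    obtain ⟨i, hi, h⟩ := O.exists_div_mem (v := B.equivFun x)
      (by rwa [Ne, LinearEquiv.map_eq_zero_iff])
    refine ⟨(B.equivFun x i)⁻¹, fun j => ⟨_, h j⟩, inv_ne_zero hi,
      ⟨i, Subtype.ext (div_self hi)⟩, ?_⟩
    nth_rewrite 2 [← B.sum_equivFun x]
    rw [Finset.smul_sum]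
    exact Finset.sum_congr rfl fun j _ => by simp only [smul_smul, div_eq_inv_mul]
  refine ⟨fun {x y} hxy => ?_⟩
  by_contra! hne
  obtain ⟨a, v, ha, ⟨i₀, hi₀⟩, hv⟩ := hscale x hne.1
  obtain ⟨a', w, ha', ⟨j₀, hj₀⟩, hw⟩ := hscale y hne.2
  have h1 : ∑ s, (∑ i, ∑ j, (v i : L) * w j * algebraMap K L (algebraMap k K (c i j s))) • B s =
      0 := by
    rw [← sum_smul_mul_sum_smul hB, ← hv, ← hw, smul_mul_smul_comm, hxy, smul_zero]
  have h2 := Fintype.linearIndependent_iff.1 B.linearIndependent _ h1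
  have h3 : ∀ s, ∑ i, ∑ j, π (v i) * π (w j) * c i j s = 0 := by
    intro s
    have h4 : ∑ i, ∑ j, v i * w j * ⟨_, hO (c i j s)⟩ = 0 := by
      apply Subtype.ext
      push_cast
      exact h2 s
    have h5 := congrArg π h4
    simpa only [map_sum, map_mul, map_zero, hπ] using h5
  have h4 : (∑ i, algebraMap k K (π (v i)) • b i) * ∑ j, algebraMap k K (π (w j)) • b j = 0 := by
    rw [sum_smul_mul_sum_smul hc]
    refine Finset.sum_eq_zero fun s _ => ?_
    have h5 := congrArg (algebraMap k K) (h3 s)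
    simp only [map_mul, map_sum, map_zero] at h5
    rw [h5, zero_smul]
  rcases mul_eq_zero.1 h4 with h | h
  · have := Fintype.linearIndependent_iff.1 b.linearIndependent _ h i₀
    simp [hi₀] at this
  · have := Fintype.linearIndependent_iff.1 b.linearIndependent _ h j₀
    simp [hj₀] at this

section Galois

variable {K L F : Type*} [Field K] [Field L] [Algebra K L] [DivisionRing F] [Algebra K F]
  [Algebra.IsCentral K F]

theorem exists_tmul_one_of_commute (x : L ⊗[K] F)
    (hx : ∀ f : F, (1 ⊗ₜ f) * x = x * (1 ⊗ₜ f)) : ∃ l : L, x = l ⊗ₜ 1 := by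
  have h1 : x ∈ Subalgebra.centralizer K
      ((Algebra.TensorProduct.includeRight : F →ₐ[K] L ⊗[K] F).range : Set (L ⊗[K] F)) := by
    rw [Subalgebra.mem_centralizer_iff]
    rintro _ ⟨f, rfl⟩
    exact hx f
  rw [Subalgebra.centralizer_range_includeRight_eq_center_tensorProduct] at h1
  clear hx
  obtain ⟨t, rfl⟩ := h1
  induction t using TensorProduct.induction_on with
  | zero => exact ⟨0, by simp⟩
  | tmul l z =>
    obtain ⟨a, ha⟩ := Algebra.IsCentral.out z.2
    refine ⟨a • l, ?_⟩
    change l ⊗ₜ (z : F) = _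
    rw [← ha, TensorProduct.smul_tmul]
    congr 1
    exact Algebra.algebraMap_eq_smul_one a
  | add s t hs ht =>
    obtain ⟨l, hl⟩ := hs
    obtain ⟨m, hm⟩ := ht
    exact ⟨l + m, by rw [map_add, hl, hm, TensorProduct.add_tmul]⟩

theorem exists_algEquiv_of_fix [FiniteDimensional K L] (σ : (L ⊗[K] F) ≃+* (L ⊗[K] F))
    (hσ : ∀ f : F, σ (1 ⊗ₜ f) = 1 ⊗ₜ f) :
    ∃ τ : L ≃ₐ[K] L, ∀ x, σ x = Algebra.TensorProduct.congr τ AlgEquiv.refl x := by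
  have hinj : Function.Injective (Algebra.TensorProduct.includeLeft : L →ₐ[K] L ⊗[K] F) :=
    Algebra.TensorProduct.includeLeft_injective (algebraMap K F).injective
  have h1 : ∀ l : L, ∃ l' : L, σ (l ⊗ₜ 1) = l' ⊗ₜ 1 := by
    intro l
    refine exists_tmul_one_of_commute _ fun f => ?_
    rw [← hσ f, ← map_mul, ← map_mul]
    simp
  choose g hg using h1
  have hgK : ∀ a, g (algebraMap K L a) = algebraMap K L a := by
    intro a
    apply hinj
    change g _ ⊗ₜ 1 = algebraMap K L a ⊗ₜ 1
    rw [← hg, Algebra.algebraMap_eq_smul_one, TensorProduct.smul_tmul, hσ]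
  let τ : L →ₐ[K] L :=
    { toFun := g
      map_one' := by simpa using hgK 1
      map_zero' := by simpa using hgK 0
      map_mul' := fun x y => hinj (by
        change g (x * y) ⊗ₜ 1 = (g x * g y) ⊗ₜ 1
        rw [← hg, ← one_mul (1 : F), ← Algebra.TensorProduct.tmul_mul_tmul,
          ← Algebra.TensorProduct.tmul_mul_tmul, map_mul, hg, hg])
      map_add' := fun x y => hinj (by
        change g (x + y) ⊗ₜ 1 = (g x + g y) ⊗ₜ 1
        rw [← hg, TensorProduct.add_tmul, TensorProduct.add_tmul, map_add, hg, hg])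
      commutes' := hgK }
  refine ⟨AlgEquiv.ofBijective τ (Algebra.IsAlgebraic.algHom_bijective τ), fun x => ?_⟩
  induction x using TensorProduct.induction_on with
  | zero => simp
  | tmul l f =>
    have h2 : l ⊗ₜ[K] f = l ⊗ₜ 1 * 1 ⊗ₜ f := by simp
    rw [h2, map_mul, hg, hσ, ← h2, Algebra.TensorProduct.congr_apply]
    simp [τ]
  | add s t hs ht => rw [map_add, map_add, hs, ht]

omit [Algebra.IsCentral K F] in
theorem mem_range_includeRight_of_fixed [FiniteDimensional K L] [IsGalois K L] (x : L ⊗[K] F)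
    (hx : ∀ τ : L ≃ₐ[K] L, Algebra.TensorProduct.congr τ (AlgEquiv.refl : F ≃ₐ[K] F) x = x) :
    ∃ f : F, x = 1 ⊗ₜ f := by
  let b := Module.Basis.ofVectorSpace K F
  let B := Algebra.TensorProduct.basis L b
  have h1 : ∀ (τ : L ≃ₐ[K] L) (y : L ⊗[K] F) i,
      B.repr (Algebra.TensorProduct.congr τ (AlgEquiv.refl : F ≃ₐ[K] F) y) i = τ (B.repr y i) := by
    intro τ y i
    induction y using TensorProduct.induction_on with
    | zero => simp
    | tmul l f => simp [B, Algebra.TensorProduct.basis_repr_tmul]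
    | add s t hs ht => simp only [map_add, Finsupp.add_apply, hs, ht]
  have h2 : ∀ i, ∃ a : K, algebraMap K L a = B.repr x i := by
    intro i
    have : B.repr x i ∈ (⊥ : IntermediateField K L) := by
      rw [IsGalois.mem_bot_iff_fixed]
      intro τ
      rw [← h1, hx]
    exact this
  choose a ha using h2
  refine ⟨(B.repr x).sum fun i _ => a i • b i, ?_⟩
  conv_lhs => rw [← B.linearCombination_repr x, Finsupp.linearCombination_apply]
  rw [Finsupp.sum, Finsupp.sum, TensorProduct.tmul_sum]
  refine Finset.sum_congr rfl fun i _ => ?_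
  rw [← ha, TensorProduct.tmul_smul, algebraMap_smul, Algebra.TensorProduct.basis_apply]

end Galois

open Polynomial

theorem exists_isGaloisExt_of_structure_constants {k K F : Type u} {ι G : Type*} [Field k]
    [Infinite k] [Field K] [DivisionRing F] [Algebra K F] [Algebra.IsCentral K F] [Algebra k[X] K]
    [IsFractionRing k[X] K] [Fintype ι] (b : Module.Basis ι K F) (c : ι → ι → ι → k)
    (hc : ∀ i j, b i * b j = ∑ s, algebraMap k[X] K (C (c i j s)) • b s)
    [CommGroup G] [Finite G] :
    ∃ (M : Type u) (instM : DivisionRing M),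
      letI := instM
      ∃ ι : F →+* M, Function.Injective ι ∧ IsGaloisExt ι ∧
        Nonempty (fixingAut ι ≃* G) := by
  obtain ⟨L, _, _, hfin, hG, ⟨e⟩, O, π, hπ⟩ := SeriesExpansion.exists_isGalois_with_place k K G
  let _ : Algebra k K := ((algebraMap k[X] K).comp C).toAlgebra
  have : NoZeroDivisors (L ⊗[K] F) := noZeroDivisors_tensorProduct_of_place b c hc O π hπ
  have : Nontrivial (L ⊗[K] F) :=
    (Algebra.TensorProduct.includeLeft_injective (R := K) (S := K) (A := L) (B := F)
      (algebraMap K F).injective).nontrivial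
  have : IsDomain (L ⊗[K] F) := NoZeroDivisors.to_isDomain _
  have : FiniteDimensional K F := b.finiteDimensional_of_finite
  let instM : DivisionRing (L ⊗[K] F) := divisionRingOfFiniteDimensional L (L ⊗[K] F)
  let j : F →+* L ⊗[K] F := (Algebra.TensorProduct.includeRight : F →ₐ[K] L ⊗[K] F).toRingHom
  let Φ : (L ≃ₐ[K] L) →* fixingAut j :=
    { toFun := fun τ => ⟨(Algebra.TensorProduct.congr τ (AlgEquiv.refl : F ≃ₐ[K] F)).toRingEquiv,
        fun f => by
          change Algebra.TensorProduct.congr τ (AlgEquiv.refl : F ≃ₐ[K] F) (1 ⊗ₜ f) = 1 ⊗ₜ f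
          simp⟩
      map_one' := by
        apply Subtype.ext
        apply RingEquiv.ext
        intro x
        change Algebra.TensorProduct.congr 1 (AlgEquiv.refl : F ≃ₐ[K] F) x = x
        induction x using TensorProduct.induction_on with
        | zero => simp
        | tmul l f => simp
        | add s t hs ht => rw [map_add, hs, ht]
      map_mul' := fun σ τ => by
        apply Subtype.ext
        apply RingEquiv.ext
        intro x
        change Algebra.TensorProduct.congr (σ * τ) (AlgEquiv.refl : F ≃ₐ[K] F) x =
          Algebra.TensorProduct.congr σ (AlgEquiv.refl : F ≃ₐ[K] F)
            (Algebra.TensorProduct.congr τ (AlgEquiv.refl : F ≃ₐ[K] F) x)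
        induction x using TensorProduct.induction_on with
        | zero => simp
        | tmul l f => simp
        | add s t hs ht => rw [map_add, hs, ht, map_add, map_add] }
  have hΦ : ∀ τ x, (Φ τ : RingAut (L ⊗[K] F)) x =
      Algebra.TensorProduct.congr τ (AlgEquiv.refl : F ≃ₐ[K] F) x := fun _ _ => rfl
  have hbij : Function.Bijective Φ := by
    constructor
    · intro σ τ h
      refine AlgEquiv.ext fun l => Algebra.TensorProduct.includeLeft_injective
        (R := K) (S := K) (A := L) (B := F) (algebraMap K F).injective ?_
      have h1 := hΦ σ (l ⊗ₜ 1)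
      rw [h, hΦ] at h1
      simpa using h1.symm
    · rintro ⟨σ, hσ⟩
      obtain ⟨τ, hτ⟩ := exists_algEquiv_of_fix σ hσ
      exact ⟨τ, Subtype.ext (RingEquiv.ext fun x => (hτ x).symm)⟩
  refine ⟨L ⊗[K] F, instM, j, j.injective, fun m hm => ?_,
    ⟨(MulEquiv.ofBijective Φ hbij).symm.trans e⟩⟩
  obtain ⟨f, hf⟩ := mem_range_includeRight_of_fixed m fun τ => hm _ (Φ τ).2
  exact ⟨f, hf.symm⟩

/-! ### The field of fractions of the ring of polynomial functions -/

theorem AlgebraicIndependent.exists_isFractionRing_polynomial {k Z ι : Type*} [Field k] [Field Z]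
    [Algebra k Z] {X : ι → Z} (hX : AlgebraicIndependent k X)
    (htop : IntermediateField.adjoin k (Set.range X) = ⊤) (i : ι) :
    ∃ (k₁ : IntermediateField k Z) (_ : Algebra k₁[X] Z), IsFractionRing k₁[X] Z ∧
      ∀ a : k₁, algebraMap k₁[X] Z (C a) = a := by
  let k₁ := IntermediateField.adjoin k (X '' {i}ᶜ)
  have htr : Transcendental k₁ (X i) :=
    IntermediateField.transcendental_adjoin_iff.2
      (hX.transcendental_adjoin (s := {i}ᶜ) (by simp))
  let _ : Algebra k₁[X] Z := (aeval (R := k₁) (X i)).toRingHom.toAlgebra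
  have hmap : ∀ P : k₁[X], algebraMap k₁[X] Z P = aeval (X i) P := fun _ => rfl
  have htop' : IntermediateField.adjoin k₁ {X i} = ⊤ := by
    rw [← IntermediateField.restrictScalars_eq_top_iff (K := k), eq_top_iff, ← htop,
      IntermediateField.adjoin_le_iff]
    rintro _ ⟨j, rfl⟩
    by_cases hj : j = i
    · rw [hj]
      exact IntermediateField.mem_adjoin_simple_self k₁ (X i)
    · exact _root_.algebraMap_mem (IntermediateField.adjoin k₁ {X i})
        (⟨X j, IntermediateField.subset_adjoin k _ ⟨j, hj, rfl⟩⟩ : k₁)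
  have : FaithfulSMul k₁[X] Z :=
    (faithfulSMul_iff_algebraMap_injective _ _).2 (transcendental_iff_injective.1 htr)
  refine ⟨k₁, inferInstance, IsFractionRing.of_field _ _ fun z => ?_, fun a => ?_⟩
  · have hz : z ∈ IntermediateField.adjoin k₁ {X i} := htop' ▸ trivial
    exact (IntermediateField.mem_adjoin_simple_iff k₁ z).1 hz
  · rw [hmap, aeval_C]
    rfl

namespace polyFunRing

section

variable (H : Type*) [DivisionRing H]

/-- The constant functions in the ring of polynomial functions. -/
def constHom : H →+* polyFunRing H where
  toFun c := ⟨Function.const H c, Subring.subset_closure (Or.inl ⟨c, rfl⟩)⟩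
  map_one' := rfl
  map_zero' := rfl
  map_mul' _ _ := rfl
  map_add' _ _ := rfl

variable {H} in
theorem linearMap_mem [FiniteDimensional (Subring.center H) H] (f : H →ₗ[Subring.center H] H) :
    (f : H → H) ∈ polyFunRing H := by
  obtain ⟨n, a, b, hf⟩ := DivisionRing.exists_eq_sum_mul_mul f
  have h1 : (f : H → H) = ∑ j, (constHom H (a j) : H → H) * id * (constHom H (b j) : H → H) := by
    funext x
    rw [hf, Finset.sum_apply]
    rfl
  rw [h1]
  exact sum_mem fun j _ => mul_mem (mul_mem (constHom H (a j)).2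
    (Subring.subset_closure (Or.inr rfl))) (constHom H (b j)).2

end

variable {H : Type v} [DivisionRing H] {F : Type u} [DivisionRing F] {φ : polyFunRing H →+* F}

theorem map_mem_center (hφ : IsClassicalRightQuotient φ) {r : polyFunRing H}
    (hr : ∀ h, (r : H → H) h ∈ Subring.center H) : φ r ∈ Subring.center F := by
  have h1 : ∀ s : polyFunRing H, Commute (φ s) (φ r) := by
    intro s
    rw [Commute, SemiconjBy, ← map_mul, ← map_mul]
    congr 1
    refine Subtype.ext (funext fun h => ?_)
    exact Subring.mem_center_iff.1 (hr h) _
  rw [Subring.mem_center_iff]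
  intro x
  obtain ⟨a, b, -, rfl⟩ := hφ.2 x
  exact ((h1 a).mul_left (h1 b).inv_left₀).eq

/-- The center of `H`, as constants in the center of the division ring of fractions. -/
def centerHom (hφ : IsClassicalRightQuotient φ) : Subring.center H →+* Subring.center F :=
  ((φ.comp (constHom H)).comp (Subring.center H).subtype).codRestrict (Subring.center F)
    fun c => map_mem_center hφ fun _ => c.2

theorem coe_centerHom (hφ : IsClassicalRightQuotient φ) (c : Subring.center H) :
    (centerHom hφ c : F) = φ (constHom H c) := rfl

variable [FiniteDimensional (Subring.center H) H] {ι : Type*}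
  (b : Module.Basis ι (Subring.center H) H)

/-- The coordinate functions with respect to a basis of `H` over its center. -/
noncomputable def coordFun (i : ι) : polyFunRing H :=
  ⟨_, linearMap_mem ((Algebra.linearMap (Subring.center H) H).comp (b.coord i))⟩

/-- The coordinate functions, as elements of the center of the division ring of fractions. -/
noncomputable def centralCoord (hφ : IsClassicalRightQuotient φ) (i : ι) : Subring.center F :=
  ⟨φ (coordFun b i), map_mem_center hφ fun h => (b.repr h i).2⟩

theorem sum_coordFun_mul_constHom [Fintype ι] :
    ∑ i, coordFun b i * constHom H (b i) = ⟨id, Subring.subset_closure (Or.inr rfl)⟩ := by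
  refine Subtype.ext (funext fun h => ?_)
  rw [AddSubmonoidClass.coe_finsetSum, Finset.sum_apply]
  exact b.sum_repr h

theorem algebraicIndependent_centralCoord [Finite ι] [Infinite (Subring.center H)]
    (hφ : IsClassicalRightQuotient φ) :
    letI := (centerHom hφ).toAlgebra
    AlgebraicIndependent (Subring.center H) (centralCoord b hφ) := by
  let _ := (centerHom hφ).toAlgebra
  have := Fintype.ofFinite ι
  have h1 : ∀ P : MvPolynomial ι (Subring.center H), ∃ r : polyFunRing H,
      (∀ h, (r : H → H) h = (MvPolynomial.eval (b.repr h) P : Subring.center H)) ∧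
      φ r = (MvPolynomial.aeval (centralCoord b hφ) P : Subring.center F) := by
    intro P
    induction P using MvPolynomial.induction_on with
    | C a =>
      refine ⟨constHom H a, fun h => by rw [MvPolynomial.eval_C]; rfl, ?_⟩
      rw [MvPolynomial.aeval_C]
      rfl
    | add P Q hP hQ =>
      obtain ⟨r, hr, hr'⟩ := hP
      obtain ⟨s, hs, hs'⟩ := hQ
      refine ⟨r + s, fun h => ?_, by rw [map_add, map_add, hr', hs']; rfl⟩
      change (r : H → H) h + (s : H → H) h = _
      rw [hr, hs, map_add]
      rfl
    | mul_X P i hP =>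
      obtain ⟨r, hr, hr'⟩ := hP
      refine ⟨r * coordFun b i, fun h => ?_, ?_⟩
      · change (r : H → H) h * (coordFun b i : H → H) h = _
        rw [hr, map_mul, MvPolynomial.eval_X]
        rfl
      · rw [map_mul, map_mul, hr', MvPolynomial.aeval_X]
        rfl
  rw [algebraicIndependent_iff]
  intro P hP
  obtain ⟨r, hr, hr'⟩ := h1 P
  rw [hP] at hr'
  have hr0 : r = 0 := hφ.1 (by rw [hr', map_zero]; rfl)
  refine MvPolynomial.funext fun x => ?_
  have h2 := hr (b.equivFun.symm x)
  rw [hr0] at h2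
  have h3 : ⇑(b.repr (b.equivFun.symm x)) = x := b.equivFun.apply_symm_apply x
  rw [h3] at h2
  rw [map_zero]
  exact Subtype.ext h2.symm

theorem eq_mul_of_sum_eq [Fintype ι] (hφ : IsClassicalRightQuotient φ) {z : ι → Subring.center F}
    {w : Subring.center F} (h : ∑ i, z i • φ (constHom H (b i)) = w) (s : ι) :
    z s = w * centerHom hφ (b.repr 1 s) := by
  obtain ⟨n, c, d, hcd⟩ := DivisionRing.exists_eq_sum_mul_mul
    ((Algebra.linearMap (Subring.center H) H).comp (b.coord s))
  have h1 : ∀ x, φ (constHom H (b.repr x s)) =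
      ∑ j, φ (constHom H (c j)) * φ (constHom H x) * φ (constHom H (d j)) := by
    intro x
    simp only [← map_mul, ← map_sum]
    congr 2
    exact hcd x
  have h2 : ∑ j, φ (constHom H (c j)) * (∑ i, z i • φ (constHom H (b i))) *
      φ (constHom H (d j)) = z s := by
    simp only [Finset.mul_sum, Finset.sum_mul, mul_smul_comm, smul_mul_assoc]
    rw [Finset.sum_comm]
    simp only [← Finset.smul_sum, ← h1]
    classical
    rw [Finset.sum_eq_single s]
    · simp [Algebra.smul_def]
      rfl
    · intro i _ hi
      simp [hi.symm]
    · simp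
  apply Subtype.ext
  rw [← h2, h]
  have h3 : ∀ j, φ (constHom H (c j)) * (w : F) * φ (constHom H (d j)) =
      (w : F) * (φ (constHom H (c j)) * φ (constHom H 1) * φ (constHom H (d j))) := by
    intro j
    rw [Subring.mem_center_iff.1 w.2 (φ (constHom H (c j))), map_one, map_one, mul_one, mul_assoc]
  simp only [h3, ← Finset.mul_sum, ← h1]
  rfl

omit [FiniteDimensional (Subring.center H) H] in
theorem map_constHom_eq_sum [Fintype ι] (hφ : IsClassicalRightQuotient φ) (x : H) :
    φ (constHom H x) = ∑ s, centerHom hφ (b.repr x s) • φ (constHom H (b s)) := by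
  have h1 : ∀ s, centerHom hφ (b.repr x s) • φ (constHom H (b s)) =
      φ (constHom H (b.repr x s • b s)) := by
    intro s
    rw [Subring.smul_def, smul_eq_mul, coe_centerHom, ← map_mul, ← map_mul, Subring.smul_def,
      smul_eq_mul]
  simp only [h1, ← map_sum, b.sum_repr]

theorem mem_span_adjoin_centralCoord [Fintype ι] (hφ : IsClassicalRightQuotient φ) (y : F) :
    letI := (centerHom hφ).toAlgebra
    y ∈ Submodule.span (IntermediateField.adjoin (Subring.center H)
      (Set.range (centralCoord b hφ))) (Set.range fun i => φ (constHom H (b i))) := by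
  let _ := (centerHom hφ).toAlgebra
  let K₀ := IntermediateField.adjoin (Subring.center H) (Set.range (centralCoord b hφ))
  let N := Submodule.span K₀ (Set.range fun i => φ (constHom H (b i)))
  change y ∈ N
  have hconst : ∀ x, φ (constHom H x) ∈ N := by
    intro x
    rw [map_constHom_eq_sum b hφ x]
    refine sum_mem fun s _ => ?_
    exact N.smul_mem (algebraMap (Subring.center H) K₀ (b.repr x s))
      (Submodule.subset_span ⟨s, rfl⟩)
  have hmul : ∀ x y, x ∈ N → y ∈ N → x * y ∈ N := by
    intro x y hx hy
    induction hx, hy using Submodule.span_induction₂ with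
    | mem_mem x y hx hy =>
      obtain ⟨i, rfl⟩ := hx
      obtain ⟨j, rfl⟩ := hy
      simp only [← map_mul]
      exact hconst _
    | zero_left y hy => simp
    | zero_right x hx => simp
    | add_left x y z _ _ _ hx hy => rw [add_mul]; exact add_mem hx hy
    | add_right x y z _ _ _ hx hy => rw [mul_add]; exact add_mem hx hy
    | smul_left r x y _ _ h => rw [smul_mul_assoc]; exact N.smul_mem r h
    | smul_right r x y _ _ h => rw [mul_smul_comm]; exact N.smul_mem r h
  let A : Subalgebra K₀ F := N.toSubalgebra (by simpa using hconst 1) hmul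
  have hfin : FiniteDimensional K₀ A :=
    FiniteDimensional.span_of_finite K₀ (Set.finite_range fun i => φ (constHom H (b i)))
  have hφA : ∀ r : polyFunRing H, φ r ∈ A := by
    rintro ⟨r, hr⟩
    induction hr using Subring.closure_induction with
    | mem r hr =>
      rcases hr with ⟨c, rfl⟩ | rfl
      · exact hconst c
      · rw [← sum_coordFun_mul_constHom b, map_sum]
        refine sum_mem fun i _ => ?_
        rw [map_mul]
        exact N.smul_mem (⟨centralCoord b hφ i,
          IntermediateField.subset_adjoin _ _ ⟨i, rfl⟩⟩ : K₀) (Submodule.subset_span ⟨i, rfl⟩)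
    | zero => exact (map_zero φ).symm ▸ zero_mem A
    | one => exact (map_one φ).symm ▸ one_mem A
    | add r s hr hs h h' => exact (map_add φ ⟨r, hr⟩ ⟨s, hs⟩).symm ▸ add_mem h h'
    | neg r hr h => exact (map_neg φ ⟨r, hr⟩).symm ▸ neg_mem h
    | mul r s hr hs h h' => exact (map_mul φ ⟨r, hr⟩ ⟨s, hs⟩).symm ▸ mul_mem h h'
  obtain ⟨r, s, hs, rfl⟩ := hφ.2 y
  have hs0 : (⟨φ s, hφA s⟩ : A) ≠ 0 := fun h =>
    hs (hφ.1 ((congrArg Subtype.val h).trans (map_zero φ).symm))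
  obtain ⟨t, ht⟩ := FiniteDimensional.exists_mul_eq_one K₀ hs0
  have ht' : φ s * (t : F) = 1 := congrArg Subtype.val ht
  rw [← eq_inv_of_mul_eq_one_right ht']
  exact hmul _ _ (hφA r) t.2

theorem adjoin_centralCoord_eq_top [Fintype ι] (hφ : IsClassicalRightQuotient φ) :
    letI := (centerHom hφ).toAlgebra
    IntermediateField.adjoin (Subring.center H) (Set.range (centralCoord b hφ)) = ⊤ := by
  let _ := (centerHom hφ).toAlgebra
  rw [eq_top_iff]
  intro z _
  obtain ⟨q, hq⟩ := (Submodule.mem_span_range_iff_exists_fun _).1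
    (mem_span_adjoin_centralCoord b hφ (z : F))
  have h1 := eq_mul_of_sum_eq b hφ (z := fun i => (q i : Subring.center F)) hq
  obtain ⟨s, hs⟩ : ∃ s, b.repr 1 s ≠ 0 := by
    by_contra! h
    exact one_ne_zero (b.repr.map_eq_zero_iff.1 (Finsupp.ext h))
  have hs' : centerHom hφ (b.repr 1 s) ≠ 0 := (_root_.map_ne_zero _).2 hs
  rw [eq_div_of_mul_eq hs' (h1 s).symm]
  exact div_mem (q s).2 (_root_.algebraMap_mem _ (b.repr 1 s))

/-- A basis of `H` over its center is a basis of the division ring of fractions over its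
center. -/
theorem exists_basis [Fintype ι] (hφ : IsClassicalRightQuotient φ) :
    ∃ B : Module.Basis ι (Subring.center F) F, ∀ i, B i = φ (constHom H (b i)) := by
  have hli : LinearIndependent (Subring.center F) fun i => φ (constHom H (b i)) := by
    rw [Fintype.linearIndependent_iff]
    intro z hz s
    rw [eq_mul_of_sum_eq b hφ (w := 0) hz s, zero_mul]
  let _ := (centerHom hφ).toAlgebra
  refine ⟨Module.Basis.mk hli fun y _ => ?_, fun i => Module.Basis.mk_apply hli _ i⟩
  exact Submodule.span_le_restrictScalars (IntermediateField.adjoin (Subring.center H)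
    (Set.range (centralCoord b hφ))) (Subring.center F) _ (mem_span_adjoin_centralCoord b hφ y)

end polyFunRing

theorem abelian_groups_are_galois_groups_over_polyFun_fractions
    {H : Type v} [DivisionRing H] [FiniteDimensional (Subring.center H) H]
    (hk : Infinite (Subring.center H))
    {F : Type u} [DivisionRing F]
    (φ : polyFunRing H →+* F) (hφ : IsClassicalRightQuotient φ)
    (G : Type w) [CommGroup G] [Finite G] :
    ∃ (M : Type u) (instM : DivisionRing M),
      letI := instM
      ∃ ι : F →+* M, Function.Injective ι ∧ IsGaloisExt ι ∧
        Nonempty (fixingAut ι ≃* G) := by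
  let b := Module.finBasis (Subring.center H) H
  let _ := (polyFunRing.centerHom hφ).toAlgebra
  obtain ⟨B, hB⟩ := polyFunRing.exists_basis b hφ
  obtain ⟨k₁, _, hfrac, hC⟩ :=
    (polyFunRing.algebraicIndependent_centralCoord b hφ).exists_isFractionRing_polynomial
      (polyFunRing.adjoin_centralCoord_eq_top b hφ) ⟨0, Module.finrank_pos⟩
  have : Infinite k₁ := Infinite.of_injective _ (algebraMap (Subring.center H) k₁).injective
  have : Algebra.IsCentral (Subring.center F) F := ⟨fun z hz => ⟨⟨z, hz⟩, rfl⟩⟩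
  refine exists_isGaloisExt_of_structure_constants B
    (fun i j s => algebraMap (Subring.center H) k₁ (b.repr (b i * b j) s)) fun i j => ?_
  simp only [hB, hC, ← map_mul]
  exact polyFunRing.map_constHom_eq_sum b hφ _
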